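/- arXiv:1107.1878 — 5 statements merged into one kernel-verified Lean document; each statement's English description precedes it below -/
import Mathlib

section
/- Let A be a polyomino and let a, b ∈ ℕ with a ≥ 1. If a < |A| and 4a ≤ b, then A is an (a,b)-loser. -/
/-- Cells of the square board. -/
abbrev Cell : Type := ℤ × ℤ

/-- Two cells are adjacent if they differ by `(±1,0)` or `(0,±1)`. -/
def Adjacent (p q : Cell) : Prop :=
  (p.1 - q.1).natAbs + (p.2 - q.2).natAbs = 1

/-- A polyomino is a finite nonempty set of cells that is connected under adjacency. -/
def IsPolyomino (A : Finset Cell) : Prop :=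
  A.Nonempty ∧ ∀ p ∈ A, ∀ q ∈ A,
    Relation.ReflTransGen (fun u v => u ∈ A ∧ v ∈ A ∧ Adjacent u v) p q

/-- A symmetry of the square lattice: a translation composed with a rotation by a
multiple of 90 degrees and possibly a reflection. -/
def IsSquareSymmetry (f : Cell → Cell) : Prop :=
  ∃ (e₁ e₂ : ℤ) (s : Bool) (t : Cell),
    (e₁ = 1 ∨ e₁ = -1) ∧ (e₂ = 1 ∨ e₂ = -1) ∧
    ∀ p : Cell, f p =
      if s then (e₁ * p.2 + t.1, e₂ * p.1 + t.2)
      else (e₁ * p.1 + t.1, e₂ * p.2 + t.2)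

/-- `P` is a placement of the polyomino `A`: the image of `A` under a symmetry
of the square lattice. -/
def IsPlacement (A : Finset Cell) (P : Set Cell) : Prop :=
  ∃ f : Cell → Cell, IsSquareSymmetry f ∧ P = f '' (↑A : Set Cell)

/-- The maker's move on his `n`-th turn (`0`-indexed), given his strategy `σ`
(a function of the list of the breaker's previous moves, which together with `σ`
determines the whole history) and the breaker's sequence of moves `β`. -/
def makerMove (σ : List (Finset Cell) → Finset Cell) (β : ℕ → Finset Cell) (n : ℕ) :
    Finset Cell :=
  σ ((List.range n).map β)

/-- The set of cells marked by the maker after his first `n` turns. -/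
def makerMarks (σ : List (Finset Cell) → Finset Cell) (β : ℕ → Finset Cell) :
    ℕ → Finset Cell
  | 0 => ∅
  | n + 1 => makerMarks σ β n ∪ makerMove σ β n

/-- The set of cells marked by the breaker after her first `n` turns. -/
def breakerMarks (β : ℕ → Finset Cell) : ℕ → Finset Cell
  | 0 => ∅
  | n + 1 => breakerMarks β n ∪ β n

/-- The maker plays legally: on every turn he marks exactly `a` previously unmarked cells. -/
def MakerLegal (a : ℕ) (σ : List (Finset Cell) → Finset Cell) (β : ℕ → Finset Cell) : Prop :=
  ∀ n, (makerMove σ β n).card = a ∧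
    Disjoint (makerMove σ β n) (makerMarks σ β n ∪ breakerMarks β n)

/-- The breaker plays legally: on every turn she marks exactly `b` previously unmarked
cells (on turn `n` she moves after the maker, so she must avoid `makerMarks σ β (n+1)`). -/
def BreakerLegal (b : ℕ) (σ : List (Finset Cell) → Finset Cell) (β : ℕ → Finset Cell) : Prop :=
  ∀ n, (β n).card = b ∧ Disjoint (β n) (makerMarks σ β (n + 1) ∪ breakerMarks β n)

/-- `A` is an `(a,b)`-winner: the maker has a winning strategy in the weak `(a,b)`
achievement game with goal `A`, i.e. a strategy that always plays legally against any
legal breaker play and eventually marks all cells of some placement of `A`. -/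
def IsWinner (A : Finset Cell) (a b : ℕ) : Prop :=
  ∃ σ : List (Finset Cell) → Finset Cell, ∀ β : ℕ → Finset Cell,
    BreakerLegal b σ β →
      MakerLegal a σ β ∧
        ∃ n, ∃ P : Set Cell, IsPlacement A P ∧ P ⊆ ↑(makerMarks σ β n)

def nbr (p : Cell) : Finset Cell :=
  {(p.1 + 1, p.2), (p.1 - 1, p.2), (p.1, p.2 + 1), (p.1, p.2 - 1)}

theorem nbr_card (p : Cell) : (nbr p).card ≤ 4 := Finset.card_le_four

theorem mem_nbr {p q : Cell} (h : Adjacent p q) : q ∈ nbr p := by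
  obtain ⟨x, y⟩ := p
  obtain ⟨z, w⟩ := q
  simp only [Adjacent] at h
  simp only [nbr, Finset.mem_insert, Finset.mem_singleton, Prod.mk.injEq]
  omega

theorem adj_symm {p q : Cell} (h : Adjacent p q) : Adjacent q p := by
  simp only [Adjacent] at *
  omega

theorem exists_reply (F N : Finset Cell) (b : ℕ) : ∃ S : Finset Cell,
    S.card = b ∧ Disjoint S F ∧ (N.card ≤ b → N ⊆ S ∪ F) := by
  classical
  have key : ∀ N : Finset Cell, N.card ≤ b → ∃ S : Finset Cell,
      S.card = b ∧ Disjoint S F ∧ N ⊆ S ∪ F := by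
    intro N hN
    have h1 : (N ∪ F).card ≤ b + F.card :=
      (Finset.card_union_le N F).trans (by omega)
    obtain ⟨t, ht, hc⟩ := Infinite.exists_superset_card_eq (N ∪ F) (b + F.card) h1
    refine ⟨t \ F, ?_, Finset.sdiff_disjoint, ?_⟩
    · rw [Finset.card_sdiff_of_subset (Finset.subset_union_right.trans ht)]
      omega
    · intro x hx
      have := ht (Finset.mem_union_left F hx)
      by_cases hF : x ∈ F <;> simp [hF, this]
  by_cases h : N.card ≤ b
  · obtain ⟨S, h1, h2, h3⟩ := key N h
    exact ⟨S, h1, h2, fun _ => h3⟩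
  · obtain ⟨S, h1, h2, h3⟩ := key ∅ (by simp)
    exact ⟨S, h1, h2, fun h' => absurd h' h⟩

noncomputable def reply (b : ℕ) (F N : Finset Cell) : Finset Cell :=
  (exists_reply F N b).choose

noncomputable def stReply (b : ℕ) (σ : List (Finset Cell) → Finset Cell)
    (s : List (Finset Cell) × Finset Cell × Finset Cell) : Finset Cell :=
  reply b ((s.2.1 ∪ σ s.1) ∪ s.2.2) ((σ s.1).biUnion nbr)

noncomputable def st (b : ℕ) (σ : List (Finset Cell) → Finset Cell) :
    ℕ → List (Finset Cell) × Finset Cell × Finset Cell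
  | 0 => ([], ∅, ∅)
  | n + 1 => ((st b σ n).1 ++ [stReply b σ (st b σ n)],
      (st b σ n).2.1 ∪ σ (st b σ n).1, (st b σ n).2.2 ∪ stReply b σ (st b σ n))

noncomputable def brk (b : ℕ) (σ : List (Finset Cell) → Finset Cell) (n : ℕ) : Finset Cell :=
  stReply b σ (st b σ n)

theorem st_eq (b : ℕ) (σ : List (Finset Cell) → Finset Cell) (n : ℕ) :
    st b σ n = ((List.range n).map (brk b σ), makerMarks σ (brk b σ) n,
      breakerMarks (brk b σ) n) := by
  induction n with
  | zero => simp [st, makerMarks, breakerMarks]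
  | succ n ih =>
    have h : stReply b σ (st b σ n) = brk b σ n := rfl
    rw [st, h, ih]
    simp [makerMarks, breakerMarks, List.range_succ, makerMove]

theorem brk_eq (b : ℕ) (σ : List (Finset Cell) → Finset Cell) (n : ℕ) :
    brk b σ n = reply b (makerMarks σ (brk b σ) (n + 1) ∪ breakerMarks (brk b σ) n)
      ((makerMove σ (brk b σ) n).biUnion nbr) := by
  conv_lhs => rw [brk, st_eq]
  rfl

theorem makerMarks_mono (σ : List (Finset Cell) → Finset Cell) (β : ℕ → Finset Cell) :
    Monotone (makerMarks σ β) :=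
  monotone_nat_of_le_succ fun _ => Finset.subset_union_left

theorem breakerMarks_mono (β : ℕ → Finset Cell) : Monotone (breakerMarks β) :=
  monotone_nat_of_le_succ fun _ => Finset.subset_union_left

theorem mem_makerMarks {σ : List (Finset Cell) → Finset Cell} {β : ℕ → Finset Cell}
    {n : ℕ} {x : Cell} (h : x ∈ makerMarks σ β n) : ∃ i, x ∈ makerMove σ β i := by
  induction n with
  | zero => simp [makerMarks] at h
  | succ n ih =>
    rcases Finset.mem_union.1 h with h | h
    · exact ih h
    · exact ⟨n, h⟩

theorem sym_adj {f : Cell → Cell} (hf : IsSquareSymmetry f) {p q : Cell}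
    (h : Adjacent p q) : Adjacent (f p) (f q) := by
  obtain ⟨e₁, e₂, s, t, h1, h2, hf⟩ := hf
  rw [hf, hf]
  simp only [Adjacent] at *
  rcases h1 with rfl | rfl <;> rcases h2 with rfl | rfl <;> cases s <;> simp <;> omega

theorem sym_inj {f : Cell → Cell} (hf : IsSquareSymmetry f) : Function.Injective f := by
  obtain ⟨e₁, e₂, s, t, h1, h2, hf⟩ := hf
  rintro ⟨x, y⟩ ⟨z, w⟩ h
  rw [hf, hf] at h
  rcases h1 with rfl | rfl <;> rcases h2 with rfl | rfl <;> cases s <;>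
    simp at h ⊢ <;> omega

/-- If `1 ≤ a < |A|` and `4a ≤ b`, then the polyomino `A` is an `(a,b)`-loser. -/
theorem surround_loser (A : Finset Cell) (a b : ℕ) (hA : IsPolyomino A)
    (ha : 1 ≤ a) (hcard : a < A.card) (hb : 4 * a ≤ b) : ¬ IsWinner A a b := by
  classical
  rintro ⟨σ, hσ⟩
  set β := brk b σ with hβ
  have spec : ∀ n, (β n).card = b ∧ Disjoint (β n) (makerMarks σ β (n + 1) ∪ breakerMarks β n) ∧
      (((makerMove σ β n).biUnion nbr).card ≤ b → (makerMove σ β n).biUnion nbr ⊆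
        β n ∪ (makerMarks σ β (n + 1) ∪ breakerMarks β n)) := by
    intro n
    have h := (exists_reply (makerMarks σ β (n + 1) ∪ breakerMarks β n)
      ((makerMove σ β n).biUnion nbr) b).choose_spec
    have e : β n = (exists_reply (makerMarks σ β (n + 1) ∪ breakerMarks β n)
      ((makerMove σ β n).biUnion nbr) b).choose := brk_eq b σ n
    rw [← e] at h
    exact h
  obtain ⟨hM, n, P, ⟨f, hf, rfl⟩, hP⟩ := hσ β fun n => ⟨(spec n).1, (spec n).2.1⟩
  have nb : ∀ i u v, u ∈ makerMove σ β i → Adjacent u v →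
      v ∈ makerMarks σ β (i + 1) ∪ breakerMarks β (i + 1) := by
    intro i u v hu huv
    have hc : ((makerMove σ β i).biUnion nbr).card ≤ b := by
      have := Finset.card_biUnion_le_card_mul (makerMove σ β i) nbr 4 fun x _ => nbr_card x
      rw [(hM i).1] at this
      omega
    have := (spec i).2.2 hc (Finset.mem_biUnion.2 ⟨u, hu, mem_nbr huv⟩)
    simp only [Finset.mem_union, breakerMarks] at this ⊢
    tauto
  have le : ∀ i j u v, u ∈ makerMove σ β i → v ∈ makerMove σ β j → Adjacent u v → j ≤ i := by
    intro i j u v hu hv huv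
    by_contra! hlt
    refine Finset.disjoint_left.1 (hM j).2 hv ?_
    exact Finset.union_subset_union (makerMarks_mono σ β hlt) (breakerMarks_mono β hlt)
      (nb i u v hu huv)
  have hmem : ∀ p ∈ A, ∃ i, f p ∈ makerMove σ β i := fun p hp =>
    mem_makerMarks (Finset.mem_coe.1 (hP ⟨p, hp, rfl⟩))
  obtain ⟨p, hp⟩ := hA.1
  obtain ⟨i, hi⟩ := hmem p hp
  have all : ∀ q ∈ A, f q ∈ makerMove σ β i := by
    intro q hq
    have h := hA.2 p hp q hq
    clear hq
    induction h with
    | refl => exact hi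
    | tail _ h ih =>
      obtain ⟨_, hv, hadj⟩ := h
      obtain ⟨j, hj⟩ := hmem _ hv
      have h1 := le _ _ _ _ ih hj (sym_adj hf hadj)
      have h2 := le _ _ _ _ hj ih (adj_symm (sym_adj hf hadj))
      rwa [le_antisymm h2 h1]
  have : A.card ≤ (makerMove σ β i).card :=
    Finset.card_le_card_of_injOn f all (sym_inj hf).injOn
  rw [(hM i).1] at this
  omega
end

section
/- Let A be a polyomino with |A| = a + 1 where a ≥ 1. Assume there exist placements A₁, …, A_k of A on the board and a cell x such that x ∈ A_i for every i and A_i ∩ A_j = {x} for all i ≠ j in {1,…,k}. If a·k > b, then A is an (a,b)-winner. -/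
/-- maker's marks, as a function of the reversed list of the breaker's moves -/
def histMarks (g : Finset Cell → Finset Cell → Finset Cell) :
    List (Finset Cell) → Finset Cell × Finset Cell
  | [] => (∅, ∅)
  | c :: l => ((histMarks g l).1 ∪ g (histMarks g l).1 (histMarks g l).2, (histMarks g l).2 ∪ c)

def histStrat (g : Finset Cell → Finset Cell → Finset Cell) (l : List (Finset Cell)) :
    Finset Cell :=
  g (histMarks g l.reverse).1 (histMarks g l.reverse).2

lemma histMarks_eq (g : Finset Cell → Finset Cell → Finset Cell) (β : ℕ → Finset Cell) (n : ℕ) :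
    histMarks g ((List.range n).map β).reverse
      = (makerMarks (histStrat g) β n, breakerMarks β n) := by
  induction n with
  | zero => simp [histMarks, makerMarks, breakerMarks]
  | succ n ih =>
    rw [List.range_succ, List.map_append, List.reverse_append]
    simp only [List.map_cons, List.map_nil, List.reverse_cons, List.reverse_nil, List.nil_append,
      List.cons_append, histMarks, ih, makerMarks, breakerMarks, makerMove, histStrat]

lemma histMove_eq (g : Finset Cell → Finset Cell → Finset Cell) (β : ℕ → Finset Cell) (n : ℕ) :
    makerMove (histStrat g) β n = g (makerMarks (histStrat g) β n) (breakerMarks β n) := by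
  rw [makerMove, histStrat, histMarks_eq]

lemma sqsym_inj {f : Cell → Cell} (h : IsSquareSymmetry f) : Function.Injective f := by
  obtain ⟨e₁, e₂, s, t, h1, h2, hf⟩ := h
  intro p q hpq
  rw [hf, hf] at hpq
  rcases h1 with rfl | rfl <;> rcases h2 with rfl | rfl <;> cases s <;>
    simp at hpq <;> ext <;> simp [hpq]

lemma placement_translate {A : Finset Cell} {Q : Set Cell} (h : IsPlacement A Q) (v : Cell) :
    IsPlacement A ((fun p => p + v) '' Q) := by
  obtain ⟨f, ⟨e₁, e₂, s, t, h1, h2, hf⟩, rfl⟩ := h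
  refine ⟨fun p => f p + v, ⟨e₁, e₂, s, t + v, h1, h2, ?_⟩, ?_⟩
  · intro p
    simp only [hf]
    cases s <;> ext <;> simp <;> ring
  · rw [Set.image_image]

lemma pigeon {ι : Type*} [Fintype ι] (T : ι → Finset Cell)
    (hT : ∀ i j, i ≠ j → Disjoint (T i) (T j)) (B : Finset Cell) (hB : B.card < Fintype.card ι) :
    ∃ i, Disjoint (T i) B := by
  by_contra hcon
  push Not at hcon
  have : ∀ i, ∃ c, c ∈ T i ∧ c ∈ B := fun i => Finset.not_disjoint_iff.1 (hcon i)
  choose f hf1 hf2 using this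
  have hinj : Function.Injective f := by
    intro i j hij
    by_contra hne
    exact Finset.disjoint_left.1 (hT i j hne) (hf1 i) (hij ▸ hf1 j)
  have := Finset.card_le_card_of_injOn (s := Finset.univ) (t := B) f (fun i _ => hf2 i)
    hinj.injOn
  rw [Finset.card_univ] at this
  omega

lemma shift_unique (R : ℤ) (x1 p q : ℤ) (i j : ℤ) (hp : |p - x1| ≤ R) (hq : |q - x1| ≤ R)
    (h : p + i * (2 * R + 1) = q + j * (2 * R + 1)) : i = j := by
  rw [abs_le] at hp hq
  have e : (i - j) * (2 * R + 1) = q - p := by linarith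
  by_contra hne
  rcases lt_or_gt_of_ne hne with h1 | h1
  · nlinarith
  · nlinarith

lemma setup (A : Finset Cell) (a b k : ℕ)
    (hcard : A.card = a + 1) (P : Fin k → Set Cell) (x : Cell)
    (hplace : ∀ i, IsPlacement A (P i)) (hx : ∀ i, x ∈ P i)
    (hinter : ∀ i j, i ≠ j → P i ∩ P j = {x}) (hk : b < a * k) :
    ∃ C : Finset Cell, C.card = a ∧ ∀ B : Finset Cell, B.card = b →
      ∃ S : Finset Cell, S.card = a ∧ Disjoint S (C ∪ B) ∧
        ∃ Q : Set Cell, IsPlacement A Q ∧ Q ⊆ ↑(C ∪ S) := by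
  have hfin : ∀ i, ∃ Q : Finset Cell, (Q : Set Cell) = P i ∧ Q.card = a + 1 := by
    intro i
    obtain ⟨f, hf, hPf⟩ := hplace i
    exact ⟨A.image f, by simp [hPf], by rw [Finset.card_image_of_injective _ (sqsym_inj hf), hcard]⟩
  choose Q hQP hQc using hfin
  have hxQ : ∀ i, x ∈ Q i := fun i => by
    have := hx i
    rw [← hQP] at this
    exact this
  obtain ⟨R, hR0, hR⟩ : ∃ R : ℤ, 0 ≤ R ∧ ∀ j, ∀ p ∈ Q j, |p.1 - x.1| ≤ R := by
    refine ⟨∑ j, ∑ p ∈ Q j, |p.1 - x.1|, by positivity, fun j p hp => ?_⟩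
    calc |p.1 - x.1| ≤ ∑ p ∈ Q j, |p.1 - x.1| :=
          Finset.single_le_sum (f := fun p : Cell => |p.1 - x.1|) (fun _ _ => abs_nonneg _) hp
      _ ≤ _ := Finset.single_le_sum (f := fun j => ∑ p ∈ Q j, |p.1 - x.1|)
          (fun _ _ => by positivity) (Finset.mem_univ j)
  let v : Fin a → Cell := fun i => ((i : ℤ) * (2 * R + 1), 0)
  have hsep : ∀ p q : Cell, |p.1 - x.1| ≤ R → |q.1 - x.1| ≤ R → ∀ i j, p + v i = q + v j →
      i = j ∧ p = q := by
    intro p q hp hq i j h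
    have h1 : p.1 + (i : ℤ) * (2 * R + 1) = q.1 + (j : ℤ) * (2 * R + 1) := congrArg Prod.fst h
    have h2 := shift_unique R x.1 p.1 q.1 i j hp hq h1
    have h3 : i = j := by ext; exact_mod_cast h2
    subst h3
    exact ⟨rfl, add_right_cancel h⟩
  have hx0 : |x.1 - x.1| ≤ R := by simpa using hR0
  refine ⟨Finset.univ.image (fun i => x + v i), ?_, ?_⟩
  · rw [Finset.card_image_of_injective, Finset.card_univ, Fintype.card_fin]
    intro i j h
    exact (hsep x x hx0 hx0 i j h).1
  intro B hB
  obtain ⟨⟨i, j⟩, hij⟩ := pigeon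
    (fun ij : Fin a × Fin k => ((Q ij.2).erase x).image (fun p => p + v ij.1)) (by
      rintro ⟨i, j⟩ ⟨i', j'⟩ hne
      rw [Finset.disjoint_left]
      intro c hc hc'
      simp only [Finset.mem_image, Finset.mem_erase] at hc hc'
      obtain ⟨p, ⟨hpx, hp⟩, rfl⟩ := hc
      obtain ⟨q, ⟨hqx, hq⟩, h⟩ := hc'
      obtain ⟨rfl, rfl⟩ := hsep q p (hR _ _ hq) (hR _ _ hp) _ _ h
      have hjj : j ≠ j' := by rintro rfl; exact hne rfl
      have : q ∈ P j ∩ P j' := by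
        rw [← hQP, ← hQP]
        exact ⟨hp, hq⟩
      rw [hinter j j' hjj] at this
      exact hpx this) B (by simpa [hB] using hk)
  refine ⟨((Q j).erase x).image (fun p => p + v i), ?_, ?_, (fun p => p + v i) '' P j,
    placement_translate (hplace j) _, ?_⟩
  · rw [Finset.card_image_of_injective _ (add_left_injective _),
      Finset.card_erase_of_mem (hxQ j), hQc]
    rfl
  · rw [Finset.disjoint_union_right]
    refine ⟨?_, hij⟩
    rw [Finset.disjoint_left]
    intro c hc hc'
    simp only [Finset.mem_image, Finset.mem_erase, Finset.mem_univ, true_and] at hc hc'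
    obtain ⟨p, ⟨hpx, hp⟩, rfl⟩ := hc
    obtain ⟨i', h⟩ := hc'
    exact hpx (hsep x p hx0 (hR _ _ hp) _ _ h).2.symm
  · rintro c ⟨p, hp, rfl⟩
    rw [← hQP] at hp
    rw [Finset.mem_coe, Finset.mem_union]
    by_cases hpx : p = x
    · left
      subst hpx
      exact Finset.mem_image_of_mem (fun i => p + v i) (Finset.mem_univ i)
    · right
      exact Finset.mem_image_of_mem (fun p => p + v i) (Finset.mem_erase.2 ⟨hpx, hp⟩)

/-- If `|A| = a + 1` and `A` has `k` placements pairwise intersecting exactly in a common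
cell `x`, and `a·k > b`, then `A` is an `(a,b)`-winner. -/
theorem twostep_winner (A : Finset Cell) (a b k : ℕ) (hA : IsPolyomino A) (ha : 1 ≤ a)
    (hcard : A.card = a + 1) (P : Fin k → Set Cell) (x : Cell)
    (hplace : ∀ i, IsPlacement A (P i)) (hx : ∀ i, x ∈ P i)
    (hinter : ∀ i j, i ≠ j → P i ∩ P j = {x}) (hk : b < a * k) :
    IsWinner A a b := by
  classical
  obtain ⟨C, hCc, hC⟩ := setup A a b k hcard P x hplace hx hinter hk
  have key : ∀ M B : Finset Cell, ∃ S : Finset Cell, S.card = a ∧ Disjoint S (M ∪ B) ∧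
      ((∃ S' : Finset Cell, S'.card = a ∧ Disjoint S' (M ∪ B) ∧
        ∃ Q : Set Cell, IsPlacement A Q ∧ Q ⊆ ↑(M ∪ S')) →
          ∃ Q : Set Cell, IsPlacement A Q ∧ Q ⊆ ↑(M ∪ S)) ∧
      ((¬ ∃ S' : Finset Cell, S'.card = a ∧ Disjoint S' (M ∪ B) ∧
        ∃ Q : Set Cell, IsPlacement A Q ∧ Q ⊆ ↑(M ∪ S')) → M ∪ B = ∅ → S = C) := by
    intro M B
    by_cases h : ∃ S' : Finset Cell, S'.card = a ∧ Disjoint S' (M ∪ B) ∧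
        ∃ Q : Set Cell, IsPlacement A Q ∧ Q ⊆ ↑(M ∪ S')
    · obtain ⟨S, h1, h2, h3⟩ := id h
      exact ⟨S, h1, h2, fun _ => h3, fun h' => absurd h h'⟩
    · by_cases he : M ∪ B = ∅
      · exact ⟨C, hCc, by rw [he]; exact Finset.disjoint_empty_right _,
          fun h' => absurd h' h, fun _ _ => rfl⟩
      · obtain ⟨S, hS, hSc⟩ := (M ∪ B).finite_toSet.infinite_compl.exists_subset_card_eq a
        refine ⟨S, hSc, ?_, fun h' => absurd h' h, fun _ h' => absurd h' he⟩
        rw [Finset.disjoint_left]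
        intro c hc hc'
        exact hS hc hc'
  choose g hg1 hg2 hg3 hg4 using key
  refine ⟨histStrat g, fun β hβ => ⟨fun n => ?_, ?_⟩⟩
  · rw [histMove_eq]
    exact ⟨hg1 _ _, hg2 _ _⟩
  · have hm1 : makerMarks (histStrat g) β 1 = ∅ ∪ g ∅ ∅ := by
      rw [makerMarks, histMove_eq]
      rfl
    by_cases h0 : ∃ S' : Finset Cell, S'.card = a ∧ Disjoint S' ((∅ : Finset Cell) ∪ ∅) ∧
        ∃ Q : Set Cell, IsPlacement A Q ∧ Q ⊆ ↑(∅ ∪ S')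
    · refine ⟨1, ?_⟩
      rw [hm1]
      exact hg3 _ _ h0
    · have hgC := hg4 ∅ ∅ h0 (by simp)
      rw [hgC, Finset.empty_union] at hm1
      refine ⟨2, ?_⟩
      rw [makerMarks, histMove_eq, hm1]
      apply hg3
      have hb1 : breakerMarks β 1 = β 0 := by simp [breakerMarks]
      rw [hb1]
      exact hC (β 0) (hβ 0).1
end

section
/- Let s ≥ 1, let a₁, …, a_s, b₁, …, b_s ∈ ℕ, and set a = a₁ + ⋯ + a_s and b = b₁ + ⋯ + b_s. Let A be a polyomino. If A is a bounded (a_i→a, b_i)-winner for every i ∈ {1,…,s}, then A is an (a, b+s−1)-winner. -/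
/-- `A` is a bounded `(a → c, b)`-winner: the maker has a strategy for the `(a → c, b)`
game (he marks `a` previously unmarked cells each turn, except `c` cells on one final
turn of his choosing) winning within at most `N` of his turns and placing all of his
marks inside the finite set `F`, against every legal breaker play. -/
def IsBoundedArrowWinner (A : Finset Cell) (a c b : ℕ) : Prop :=
  ∃ (σ : List (Finset Cell) → Finset Cell) (N : ℕ) (F : Finset Cell),
    ∀ β : ℕ → Finset Cell, BreakerLegal b σ β →
      ∃ T : ℕ, T + 1 ≤ N ∧
        (∀ n ≤ T, Disjoint (makerMove σ β n) (makerMarks σ β n ∪ breakerMarks β n) ∧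
          makerMove σ β n ⊆ F) ∧
        (∀ n < T, (makerMove σ β n).card = a) ∧
        (makerMove σ β T).card = c ∧
        ∃ P : Set Cell, IsPlacement A P ∧ P ⊆ ↑(makerMarks σ β (T + 1))

def HasPl (A M : Finset Cell) : Prop := ∃ P : Set Cell, IsPlacement A P ∧ P ⊆ ↑M

theorem HasPl.mono {A M M' : Finset Cell} (h : HasPl A M) (hM : M ⊆ M') : HasPl A M' := by
  obtain ⟨P, hP, hs⟩ := h
  exact ⟨P, hP, hs.trans (by exact_mod_cast hM)⟩

theorem exists_fresh (b : ℕ) (S : Finset Cell) : ∃ X : Finset Cell, X.card = b ∧ Disjoint X S := by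
  have hinf : ((S : Set Cell)ᶜ).Infinite := S.finite_toSet.infinite_compl
  obtain ⟨X, hX, hc⟩ := hinf.exists_subset_card_eq b
  refine ⟨X, hc, ?_⟩
  rw [Finset.disjoint_left]
  intro x hx hxS
  exact hX hx (by exact_mod_cast hxS)

noncomputable def fresh (b : ℕ) (S : Finset Cell) : Finset Cell := (exists_fresh b S).choose

theorem fresh_card (b : ℕ) (S : Finset Cell) : (fresh b S).card = b :=
  (exists_fresh b S).choose_spec.1

theorem fresh_disj (b : ℕ) (S : Finset Cell) : Disjoint (fresh b S) S :=
  (exists_fresh b S).choose_spec.2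

/-! Global game -/

def WinsIn (A : Finset Cell) (a b : ℕ) : ℕ → Finset Cell → Finset Cell → Prop
  | 0, M, _ => HasPl A M
  | n + 1, M, B => ∃ X : Finset Cell, X.card = a ∧ Disjoint X (M ∪ B) ∧
      ∀ Y : Finset Cell, Y.card = b → Disjoint Y ((M ∪ X) ∪ B) → WinsIn A a b n (M ∪ X) (B ∪ Y)

theorem WinsIn.succ {A : Finset Cell} {a b : ℕ} : ∀ {n : ℕ} {M B : Finset Cell},
    WinsIn A a b n M B → WinsIn A a b (n + 1) M B
  | 0, M, B, h => ⟨fresh a (M ∪ B), fresh_card _ _, fresh_disj _ _, fun _ _ _ =>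
      HasPl.mono h Finset.subset_union_left⟩
  | _ + 1, _, _, ⟨X, h1, h2, h3⟩ => ⟨X, h1, h2, fun Y hY hY' => (h3 Y hY hY').succ⟩

theorem WinsIn.mono {A : Finset Cell} {a b n m : ℕ} {M B : Finset Cell}
    (h : WinsIn A a b n M B) (hnm : n ≤ m) : WinsIn A a b m M B := by
  induction hnm with
  | refl => exact h
  | step _ ih => exact ih.succ

open Classical in
noncomputable def mu (A : Finset Cell) (a b n : ℕ) (M B : Finset Cell) : Finset Cell :=
  if h : WinsIn A a b (n + 1) M B then h.choose else fresh a (M ∪ B)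

theorem mu_card (A : Finset Cell) (a b n : ℕ) (M B : Finset Cell) :
    (mu A a b n M B).card = a := by
  unfold mu
  split_ifs with h
  · exact h.choose_spec.1
  · exact fresh_card _ _

theorem mu_disj (A : Finset Cell) (a b n : ℕ) (M B : Finset Cell) :
    Disjoint (mu A a b n M B) (M ∪ B) := by
  unfold mu
  split_ifs with h
  · exact h.choose_spec.2.1
  · exact fresh_disj _ _

theorem mu_win {A : Finset Cell} {a b n : ℕ} {M B : Finset Cell} (h : WinsIn A a b (n + 1) M B)
    (Y : Finset Cell) (hY : Y.card = b) (hd : Disjoint Y ((M ∪ mu A a b n M B) ∪ B)) :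
    WinsIn A a b n (M ∪ mu A a b n M B) (B ∪ Y) := by
  unfold mu at hd ⊢
  rw [dif_pos h] at hd ⊢
  exact h.choose_spec.2.2 Y hY hd

/-- state: remaining rounds, maker marks, breaker marks -/
noncomputable def stp (A : Finset Cell) (a b : ℕ) (S : ℕ × Finset Cell × Finset Cell)
    (Y : Finset Cell) : ℕ × Finset Cell × Finset Cell :=
  (S.1 - 1, S.2.1 ∪ mu A a b (S.1 - 1) S.2.1 S.2.2, S.2.2 ∪ Y)

noncomputable def stt (A : Finset Cell) (a b n : ℕ) (l : List (Finset Cell)) :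
    ℕ × Finset Cell × Finset Cell := l.foldl (stp A a b) (n, ∅, ∅)

noncomputable def strat (A : Finset Cell) (a b n : ℕ) (l : List (Finset Cell)) : Finset Cell :=
  mu A a b ((stt A a b n l).1 - 1) (stt A a b n l).2.1 (stt A a b n l).2.2

theorem stt_eq (A : Finset Cell) (a b n : ℕ) (β : ℕ → Finset Cell) (m : ℕ) :
    stt A a b n ((List.range m).map β) =
      (n - m, makerMarks (strat A a b n) β m, breakerMarks β m) := by
  induction m with
  | zero => simp [stt, makerMarks, breakerMarks]
  | succ m ih =>
    have h1 : stt A a b n ((List.range (m + 1)).map β) =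
        stp A a b (stt A a b n ((List.range m).map β)) (β m) := by
      simp [stt, List.range_succ]
    have h2 : makerMove (strat A a b n) β m = mu A a b (n - m - 1)
        (makerMarks (strat A a b n) β m) (breakerMarks β m) := by
      unfold makerMove
      rw [strat, ih]
    rw [h1, ih]
    simp only [stp, makerMarks, breakerMarks, h2]
    rfl

theorem isWinner_of_winsIn {A : Finset Cell} {a b n : ℕ} (h : WinsIn A a b n ∅ ∅) :
    IsWinner A a b := by
  refine ⟨strat A a b n, fun β hβ => ?_⟩
  have h2 : ∀ m, makerMove (strat A a b n) β m = mu A a b (n - m - 1)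
      (makerMarks (strat A a b n) β m) (breakerMarks β m) := by
    intro m
    unfold makerMove
    rw [strat, stt_eq]
  refine ⟨fun m => ?_, n, ?_⟩
  · rw [h2]
    exact ⟨mu_card _ _ _ _ _ _, mu_disj _ _ _ _ _ _⟩
  · have key : ∀ d m, m + d = n → WinsIn A a b d (makerMarks (strat A a b n) β m)
        (breakerMarks β m) → HasPl A (makerMarks (strat A a b n) β n) := by
      intro d
      induction d with
      | zero => intro m hm hw; subst hm; exact hw
      | succ d ih =>
        intro m hm hw
        refine ih (m + 1) (by omega) ?_
        have h3 := h2 m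
        rw [show n - m - 1 = d by omega] at h3
        have h4 := hβ m
        simp only [makerMarks, breakerMarks, h3] at h4 ⊢
        exact mu_win hw (β m) h4.1 h4.2
    exact key n 0 (by omega) h

/-! Local game -/

def LW (A : Finset Cell) (a c b : ℕ) (F : Finset Cell) : ℕ → Finset Cell → Finset Cell → Prop
  | 0, _, _ => False
  | n + 1, M, B =>
    (∃ X : Finset Cell, X ⊆ F ∧ X.card = c ∧ Disjoint X (M ∪ B) ∧ HasPl A (M ∪ X)) ∨
    (∃ X : Finset Cell, X ⊆ F ∧ X.card = a ∧ Disjoint X (M ∪ B) ∧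
      ∀ Y : Finset Cell, Y ⊆ F → Y.card ≤ b → Disjoint Y ((M ∪ X) ∪ B) →
        LW A a c b F n (M ∪ X) (B ∪ Y))

theorem makerMove_congr (σ : List (Finset Cell) → Finset Cell) {β β' : ℕ → Finset Cell} {n : ℕ}
    (h : ∀ k < n, β k = β' k) : makerMove σ β n = makerMove σ β' n := by
  unfold makerMove
  congr 1
  apply List.map_congr_left
  intro k hk
  exact h k (List.mem_range.1 hk)

theorem makerMarks_congr (σ : List (Finset Cell) → Finset Cell) {β β' : ℕ → Finset Cell} {n : ℕ}
    (h : ∀ k, k + 1 < n → β k = β' k) : makerMarks σ β n = makerMarks σ β' n := by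
  induction n with
  | zero => rfl
  | succ n ih =>
    simp only [makerMarks]
    rw [ih (fun k hk => h k (by omega)), makerMove_congr σ (fun k hk => h k (by omega))]

theorem breakerMarks_congr {β β' : ℕ → Finset Cell} {n : ℕ}
    (h : ∀ k < n, β k = β' k) : breakerMarks β n = breakerMarks β' n := by
  induction n with
  | zero => rfl
  | succ n ih =>
    simp only [breakerMarks]
    rw [ih (fun k hk => h k (by omega)), h n (by omega)]

noncomputable def extd (b : ℕ) (σ : List (Finset Cell) → Finset Cell) (β : ℕ → Finset Cell)
    (m : ℕ) (n : ℕ) : Finset Cell :=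
  if n < m then β n else
    fresh b (makerMarks σ (fun k => if _ : k < n then extd b σ β m k else ∅) (n + 1) ∪
      breakerMarks (fun k => if _ : k < n then extd b σ β m k else ∅) n)
termination_by n

theorem extd_lt (b : ℕ) (σ : List (Finset Cell) → Finset Cell) (β : ℕ → Finset Cell)
    (m : ℕ) {n : ℕ} (h : n < m) : extd b σ β m n = β n := by
  rw [extd, if_pos h]

theorem extd_legal (b : ℕ) (σ : List (Finset Cell) → Finset Cell) (β : ℕ → Finset Cell)
    (m : ℕ) (h : ∀ n < m, (β n).card = b ∧
      Disjoint (β n) (makerMarks σ β (n + 1) ∪ breakerMarks β n)) :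
    BreakerLegal b σ (extd b σ β m) := by
  intro n
  by_cases hn : n < m
  · rw [makerMarks_congr σ (β' := β) (fun k hk => extd_lt b σ β m (by omega)),
      breakerMarks_congr (β' := β) (fun k hk => extd_lt b σ β m (by omega)), extd_lt b σ β m hn]
    exact h n hn
  · have h1 : makerMarks σ (extd b σ β m) (n + 1) =
        makerMarks σ (fun k => if _ : k < n then extd b σ β m k else ∅) (n + 1) :=
      makerMarks_congr σ (fun k hk => by simp [show k < n by omega])
    have h2 : breakerMarks (extd b σ β m) n =
        breakerMarks (fun k => if _ : k < n then extd b σ β m k else ∅) n :=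
      breakerMarks_congr (fun k hk => by simp [hk])
    rw [h1, h2]
    have h3 : extd b σ β m n = fresh b (makerMarks σ (fun k => if _ : k < n then extd b σ β m k else ∅) (n + 1) ∪
      breakerMarks (fun k => if _ : k < n then extd b σ β m k else ∅) n) := by
      rw [extd, if_neg hn]
    rw [h3]
    exact ⟨fresh_card _ _, fresh_disj _ _⟩

theorem lw_of_bounded {A : Finset Cell} {a c b : ℕ} (h : IsBoundedArrowWinner A a c b) :
    ∃ N F, LW A a c b F N ∅ ∅ := by
  obtain ⟨σ, N, F, h⟩ := h
  refine ⟨N, F, ?_⟩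
  set V : (ℕ → Finset Cell) → ℕ → Prop := fun β T => T + 1 ≤ N ∧
        (∀ n ≤ T, Disjoint (makerMove σ β n) (makerMarks σ β n ∪ breakerMarks β n) ∧
          makerMove σ β n ⊆ F) ∧
        (∀ n < T, (makerMove σ β n).card = a) ∧
        (makerMove σ β T).card = c ∧
        ∃ P : Set Cell, IsPlacement A P ∧ P ⊆ ↑(makerMarks σ β (T + 1)) with hV
  have key : ∀ d m, m + d = N → ∀ β, BreakerLegal b σ β →
      (∀ β', BreakerLegal b σ β' → (∀ k < m, β' k = β k) → ∀ T, V β' T → m ≤ T) →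
      LW A a c b F d (makerMarks σ β m) (breakerMarks β m ∩ F) := by
    intro d
    induction d with
    | zero =>
      intro m hm β hβ hno
      obtain ⟨T, hT⟩ := h β hβ
      have := hno β hβ (fun _ _ => rfl) T hT
      have := hT.1
      omega
    | succ d ih =>
      intro m hm β hβ hno
      by_cases hex : ∃ β', BreakerLegal b σ β' ∧ (∀ k < m, β' k = β k) ∧ V β' m
      · left
        obtain ⟨β', hl, hag, -, h2, -, h4, h5⟩ := hex
        have h2 := h2 m le_rfl
        rw [makerMarks_congr σ (β' := β) (fun k hk => hag k (by omega)),
          breakerMarks_congr hag] at h2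
        rw [makerMarks_congr σ (β' := β) (fun k hk => hag k (by omega))] at h5
        rw [makerMove_congr σ hag] at h2 h4
        exact ⟨_, h2.2, h4, h2.1.mono_right
          (Finset.union_subset_union_right Finset.inter_subset_left), h5⟩
      · right
        obtain ⟨T, hT⟩ := h β hβ
        have hmT : m ≤ T := hno β hβ (fun _ _ => rfl) T hT
        have hne : m ≠ T := by
          rintro rfl
          exact hex ⟨β, hβ, fun _ _ => rfl, hT⟩
        obtain ⟨h1, h2, h3, -, -⟩ := hT
        refine ⟨makerMove σ β m, (h2 m hmT).2, h3 m (by omega), (h2 m hmT).1.mono_right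
          (Finset.union_subset_union_right Finset.inter_subset_left), ?_⟩
        intro Y hYF hYc hYd
        obtain ⟨W, hWc, hWd⟩ := exists_fresh (b - Y.card)
          (F ∪ (makerMarks σ β (m + 1) ∪ breakerMarks β m))
        rw [Finset.disjoint_union_right] at hWd
        have hYW : Disjoint Y W := (hWd.1.mono_right hYF).symm
        set γ : ℕ → Finset Cell := Function.update β m (Y ∪ W) with hγ
        have hγlt : ∀ k < m, γ k = β k := fun k hk => by
          simp [hγ, Function.update_of_ne (show k ≠ m by omega)]
        have hγm : γ m = Y ∪ W := by simp [hγ]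
        set δ := extd b σ γ (m + 1) with hδ
        have hδγ : ∀ k < m + 1, δ k = γ k := fun k hk => extd_lt b σ γ (m + 1) hk
        have hδβ : ∀ k < m, δ k = β k := fun k hk => by rw [hδγ k (by omega), hγlt k hk]
        have hYd' : Disjoint Y (makerMarks σ β (m + 1) ∪ breakerMarks β m) := by
          rw [Finset.disjoint_left] at hYd ⊢
          intro x hx hx'
          refine hYd hx ?_
          rcases Finset.mem_union.1 hx' with h' | h'
          · exact Finset.mem_union_left _ h'
          · exact Finset.mem_union_right _ (Finset.mem_inter.2 ⟨h', hYF hx⟩)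
        have hδl : BreakerLegal b σ δ := by
          apply extd_legal
          intro n hn
          rw [makerMarks_congr σ (β' := β) (fun k hk => hγlt k (by omega)),
            breakerMarks_congr (β' := β) (fun k hk => hγlt k (by omega))]
          by_cases hnm : n = m
          · subst hnm
            rw [hγm, Finset.card_union_of_disjoint hYW, hWc]
            exact ⟨by omega, Finset.disjoint_union_left.2 ⟨hYd', hWd.2⟩⟩
          · rw [hγlt n (by omega)]
            exact hβ n
        have := ih (m + 1) (by omega) δ hδl (by
          intro β' hl' hag T' hT'
          have hag' : ∀ k < m, β' k = β k := fun k hk => by rw [hag k (by omega), hδβ k hk]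
          have h6 := hno β' hl' hag' T' hT'
          rcases Nat.lt_or_ge m T' with h7 | h7
          · exact h7
          · have : T' = m := by omega
            subst this
            exact absurd ⟨β', hl', hag', hT'⟩ hex)
        have e1 : makerMarks σ δ (m + 1) = makerMarks σ β m ∪ makerMove σ β m :=
          makerMarks_congr σ (fun k hk => hδβ k (by omega))
        have e2 : breakerMarks δ (m + 1) ∩ F = breakerMarks β m ∩ F ∪ Y := by
          simp only [breakerMarks]
          rw [breakerMarks_congr hδβ, hδγ m (by omega), hγm]
          ext x
          have hWx : x ∈ W → x ∉ F := fun hx => Finset.disjoint_left.1 hWd.1 hx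
          have := @hYF x
          simp only [Finset.mem_inter, Finset.mem_union]
          tauto
        rw [e1, e2] at this
        exact this
  have := key N 0 (by omega) (extd b σ (fun _ => ∅) 0) (extd_legal _ _ _ _ (by simp))
    (fun _ _ _ _ _ => Nat.zero_le _)
  simpa [makerMarks, breakerMarks] using this

/-! Translation -/

def trn (t : Cell) (S : Finset Cell) : Finset Cell := S.map (Equiv.addRight t).toEmbedding

theorem mem_trn {t : Cell} {S : Finset Cell} {x : Cell} : x ∈ trn t S ↔ x - t ∈ S := by
  simp only [trn, Finset.mem_map_equiv]
  simp [sub_eq_add_neg]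

theorem trn_union (t : Cell) (S T : Finset Cell) : trn t (S ∪ T) = trn t S ∪ trn t T := by
  ext x; simp [mem_trn]

theorem trn_subset {t : Cell} {S T : Finset Cell} (h : S ⊆ T) : trn t S ⊆ trn t T := by
  intro x hx; rw [mem_trn] at *; exact h hx

theorem trn_disj {t : Cell} {S T : Finset Cell} (h : Disjoint S T) :
    Disjoint (trn t S) (trn t T) := by
  rw [Finset.disjoint_left] at *
  intro x hx hx'; rw [mem_trn] at *; exact h hx hx'

theorem trn_card (t : Cell) (S : Finset Cell) : (trn t S).card = S.card := Finset.card_map _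

theorem trn_neg (t : Cell) (S : Finset Cell) : trn t (trn (-t) S) = S := by
  ext x; simp [mem_trn]

theorem trn_neg' (t : Cell) (S : Finset Cell) : trn (-t) (trn t S) = S := by
  ext x; simp [mem_trn]

theorem trn_hasPl {A M : Finset Cell} (t : Cell) (h : HasPl A M) : HasPl A (trn t M) := by
  obtain ⟨P, ⟨f, ⟨e₁, e₂, s, u, h1, h2, hf⟩, rfl⟩, hP⟩ := h
  refine ⟨_, ⟨fun p => f p + t, ⟨e₁, e₂, s, u + t, h1, h2, ?_⟩, rfl⟩, ?_⟩
  · intro p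
    simp only [hf]
    split_ifs <;> ext <;> simp <;> ring
  · rintro _ ⟨p, hp, rfl⟩
    have := hP ⟨p, hp, rfl⟩
    simp only [Finset.mem_coe, mem_trn] at *
    simpa using this

theorem trn_LW {A : Finset Cell} {a c b : ℕ} (t : Cell) {F : Finset Cell} : ∀ {n : ℕ}
    {M B : Finset Cell}, LW A a c b F n M B → LW A a c b (trn t F) n (trn t M) (trn t B) := by
  intro n
  induction n with
  | zero => intro M B h; exact h
  | succ n ih =>
    intro M B h
    rcases h with ⟨X, h1, h2, h3, h4⟩ | ⟨X, h1, h2, h3, h4⟩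
    · left
      refine ⟨trn t X, trn_subset h1, by rw [trn_card, h2], ?_, ?_⟩
      · rw [← trn_union]; exact trn_disj h3
      · rw [← trn_union]; exact trn_hasPl t h4
    · right
      refine ⟨trn t X, trn_subset h1, by rw [trn_card, h2], ?_, ?_⟩
      · rw [← trn_union]; exact trn_disj h3
      · intro Y hY hYc hYd
        have := ih (h4 (trn (-t) Y) ?_ ?_ ?_)
        · rwa [trn_union, trn_union, trn_neg] at this
        · have := trn_subset (t := -t) hY
          rwa [trn_neg'] at this
        · rwa [trn_card]
        · rw [← trn_union, ← trn_union] at hYd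
          have := trn_disj (t := -t) hYd
          rwa [trn_neg'] at this

theorem exists_family {s : ℕ} (F : Fin s → Finset Cell) :
    ∃ t : Fin s → ℕ → Cell, ∀ i j i' j', (∃ x, x ∈ trn (t i j) (F i) ∧ x ∈ trn (t i' j') (F i')) →
      i = i' ∧ j = j' := by
  obtain ⟨E, hE⟩ : ∃ E : ℕ, ∀ i, ∀ p ∈ F i, p.1.natAbs ≤ E := by
    refine ⟨∑ i, ∑ p ∈ F i, p.1.natAbs, fun i p hp => ?_⟩
    calc p.1.natAbs ≤ ∑ p ∈ F i, p.1.natAbs :=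
          Finset.single_le_sum (f := fun p : Cell => p.1.natAbs) (fun _ _ => Nat.zero_le _) hp
      _ ≤ _ := Finset.single_le_sum (f := fun i => ∑ p ∈ F i, p.1.natAbs)
          (fun _ _ => Nat.zero_le _) (Finset.mem_univ i)
  refine ⟨fun i j => ((2 * E + 1 : ℤ) * (Nat.pair i j : ℕ), 0), ?_⟩
  rintro i j i' j' ⟨x, hx, hx'⟩
  rw [mem_trn] at hx hx'
  have h1 := hE _ _ hx
  have h2 := hE _ _ hx'
  simp only [Prod.fst_sub] at h1 h2
  have h3 : Nat.pair i j = Nat.pair i' j' := by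
    generalize Nat.pair i j = u at *
    generalize Nat.pair i' j' = v at *
    have h1' : |x.1 - (2 * E + 1 : ℤ) * u| ≤ E := by rw [Int.abs_eq_natAbs]; exact_mod_cast h1
    have h2' : |x.1 - (2 * E + 1 : ℤ) * v| ≤ E := by rw [Int.abs_eq_natAbs]; exact_mod_cast h2
    rw [abs_le] at h1' h2'
    rcases lt_trichotomy u v with h | h | h
    · have : (u : ℤ) + 1 ≤ v := by exact_mod_cast h
      nlinarith
    · exact h
    · have : (v : ℤ) + 1 ≤ u := by exact_mod_cast h
      nlinarith
  rw [Nat.pair_eq_pair] at h3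
  exact ⟨Fin.ext h3.1, h3.2⟩

/-! Main argument -/

section Main
variable {s : ℕ} (A : Finset Cell) (av bv : Fin s → ℕ) (c : ℕ) (Fam : Fin s → ℕ → Finset Cell)

def Good (i : Fin s) (j n : ℕ) (M B : Finset Cell) : Prop :=
  LW A (av i) c (bv i) (Fam i j) n (M ∩ Fam i j) (B ∩ Fam i j)

def Pend (i : Fin s) (j n q : ℕ) (M B : Finset Cell) : Prop :=
  ∀ Y : Finset Cell, Y ⊆ Fam i j → Disjoint Y (M ∪ B) → Y.card < q →
    LW A (av i) c (bv i) (Fam i j) n (M ∩ Fam i j) (B ∩ Fam i j ∪ Y)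

variable {A av bv c Fam}

theorem Pend.good {i : Fin s} {j n q : ℕ} {M B : Finset Cell}
    (h : Pend A av bv c Fam i j n q M B) (hq : 0 < q) : Good A av bv c Fam i j n M B := by
  have := h ∅ (by simp) (by simp) (by simpa using hq)
  simpa [Good] using this

theorem Pend.breaker {i : Fin s} {j n q : ℕ} {M B Z : Finset Cell}
    (h : Pend A av bv c Fam i j n q M B) (hZ : Disjoint Z (M ∪ B)) :
    Pend A av bv c Fam i j n (q - (Z ∩ Fam i j).card) M (B ∪ Z) := by
  intro Y hY hd hc
  have h1 : (Z ∩ Fam i j ∪ Y).card ≤ (Z ∩ Fam i j).card + Y.card := Finset.card_union_le _ _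
  have := h (Z ∩ Fam i j ∪ Y) (Finset.union_subset Finset.inter_subset_right hY) (by
    rw [Finset.disjoint_union_left]
    refine ⟨hZ.mono_left Finset.inter_subset_left, hd.mono_right ?_⟩
    intro x; simp only [Finset.mem_union]; tauto) (by omega)
  rwa [← Finset.union_assoc, ← Finset.union_inter_distrib_right] at this

theorem touch_sum (hdisj : ∀ i j i' j', (∃ x, x ∈ Fam i j ∧ x ∈ Fam i' j') → i = i' ∧ j = j')
    (U : Finset ℕ) (Z : Finset Cell) :
    ∑ i, ∑ j ∈ U, (Z ∩ Fam i j).card ≤ Z.card := by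
  rw [← Finset.sum_product', ← Finset.card_biUnion]
  · apply Finset.card_le_card
    intro x hx
    simp only [Finset.mem_biUnion] at hx
    obtain ⟨p, _, hp⟩ := hx
    exact (Finset.mem_inter.1 hp).1
  · rintro ⟨i, j⟩ _ ⟨i', j'⟩ _ hne
    change Disjoint _ _
    rw [Finset.disjoint_left]
    intro x hx hx'
    have := hdisj i j i' j' ⟨x, (Finset.mem_inter.1 hx).2, (Finset.mem_inter.1 hx').2⟩
    exact hne (by rw [this.1, this.2])

theorem touch_card (hdisj : ∀ i j i' j', (∃ x, x ∈ Fam i j ∧ x ∈ Fam i' j') → i = i' ∧ j = j')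
    (i : Fin s) (G : Finset ℕ) (Z : Finset Cell) :
    (G.filter (fun j => ¬ Disjoint Z (Fam i j))).card ≤ Z.card := by
  calc (G.filter (fun j => ¬ Disjoint Z (Fam i j))).card
      = ∑ j ∈ G.filter (fun j => ¬ Disjoint Z (Fam i j)), 1 := by simp
    _ ≤ ∑ j ∈ G.filter (fun j => ¬ Disjoint Z (Fam i j)), (Z ∩ Fam i j).card := by
        apply Finset.sum_le_sum
        intro j hj
        have := (Finset.mem_filter.1 hj).2
        rw [Finset.disjoint_iff_inter_eq_empty] at this
        exact Finset.card_pos.2 (Finset.nonempty_iff_ne_empty.2 this)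
    _ ≤ ∑ i', ∑ j ∈ G.filter (fun j => ¬ Disjoint Z (Fam i j)), (Z ∩ Fam i' j).card :=
        Finset.single_le_sum (f := fun i' => ∑ j ∈ G.filter (fun j => ¬ Disjoint Z (Fam i j)), (Z ∩ Fam i' j).card)
          (fun _ _ => Nat.zero_le _) (Finset.mem_univ i)
    _ ≤ _ := touch_sum hdisj _ _

/-- One stage. -/
theorem stage (hs : 1 ≤ s)
    (hdisj : ∀ i j i' j', (∃ x, x ∈ Fam i j ∧ x ∈ Fam i' j') → i = i' ∧ j = j')
    (hc : c = ∑ i, av i) (b' : ℕ) (hb : b' + 1 = ∑ i, (bv i + 1))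
    (k : Fin s → ℕ) (R n : ℕ)
    (hend : ∀ M B, (∃ i₀, ∀ i, ∃ G : Finset ℕ, R ≤ G.card ∧
      ∀ j ∈ G, Good A av bv c Fam i j (if i = i₀ then k i else k i + 1) M B) →
      WinsIn A c b' n M B) (U : Finset ℕ) (L : ℕ) (hL : s * (R * (b' + 1)) ≤ L) :
    ∀ (l : ℕ) (M B : Finset Cell) (G : Fin s → Finset ℕ) (q : Fin s → ℕ → ℕ),
      (∀ i, G i ⊆ U) → (∀ i, R + l * (1 + b') ≤ (G i).card) →
      (∀ i, ∀ j ∈ G i, Good A av bv c Fam i j (k i + 1) M B) →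
      (∀ i, ∀ j ∈ G i, q i j = 0) →
      (∀ i j, q i j ≤ b' + 1) →
      (∀ i j, Pend A av bv c Fam i j (k i) (q i j) M B) →
      L ≤ l + ∑ i, ∑ j ∈ U, q i j →
      WinsIn A c b' (l + n) M B := by
  intro l
  induction l with
  | zero =>
    intro M B G q hGU hGc hGg hq0 hqb hqp hsum
    rw [Nat.zero_add]
    apply hend
    have : ∃ i₀ : Fin s, R * (b' + 1) ≤ ∑ j ∈ U, q i₀ j := by
      by_contra hcon
      push Not at hcon
      have h1 : ∑ i : Fin s, ∑ j ∈ U, q i j < ∑ i : Fin s, R * (b' + 1) :=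
        Finset.sum_lt_sum_of_nonempty ⟨⟨0, hs⟩, Finset.mem_univ _⟩ (fun i _ => hcon i)
      simp only [Finset.sum_const, Finset.card_univ, Fintype.card_fin, smul_eq_mul] at h1
      omega
    obtain ⟨i₀, hi₀⟩ := this
    refine ⟨i₀, fun i => ?_⟩
    by_cases hi : i = i₀
    · subst hi
      refine ⟨U.filter (fun j => 0 < q i j), ?_, ?_⟩
      · have h2 : ∑ j ∈ U, q i j ≤ (U.filter (fun j => 0 < q i j)).card * (b' + 1) := by
          rw [Finset.card_filter, Finset.sum_mul]
          apply Finset.sum_le_sum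
          intro j _
          have := hqb i j
          split_ifs <;> omega
        exact Nat.le_of_mul_le_mul_right (hi₀.trans h2) (Nat.succ_pos _)
      · intro j hj
        rw [if_pos rfl]
        exact (hqp i j).good (Finset.mem_filter.1 hj).2
    · refine ⟨G i, by have := hGc i; omega, fun j hj => ?_⟩
      rw [if_neg hi]
      exact hGg i j hj
  | succ l ih =>
    intro M B G q hGU hGc hGg hq0 hqb hqp hsum
    have hne : ∀ i, ∃ j, j ∈ G i := fun i => by
      apply Finset.card_pos.1
      have := hGc i
      have h2 : 0 < (l + 1) * (1 + b') := by positivity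
      omega
    choose J hJ using hne
    by_cases hwin : ∃ i, ∃ X : Finset Cell, X ⊆ Fam i (J i) ∧ X.card = c ∧
        Disjoint X ((M ∩ Fam i (J i)) ∪ (B ∩ Fam i (J i))) ∧ HasPl A ((M ∩ Fam i (J i)) ∪ X)
    · obtain ⟨i, X, hXF, hXc, hXd, hXp⟩ := hwin
      have : WinsIn A c b' 1 M B := by
        refine ⟨X, hXc, ?_, fun Y _ _ => ?_⟩
        · rw [Finset.disjoint_left] at hXd ⊢
          intro x hx hx'
          apply hXd hx
          have := hXF hx
          simp only [Finset.mem_union, Finset.mem_inter] at hx' ⊢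
          tauto
        · exact hXp.mono (Finset.union_subset_union_left Finset.inter_subset_left)
      exact this.mono (by omega)
    · have hmv : ∀ i, ∃ X : Finset Cell, X ⊆ Fam i (J i) ∧ X.card = av i ∧
          Disjoint X ((M ∩ Fam i (J i)) ∪ (B ∩ Fam i (J i))) ∧
          ∀ Y : Finset Cell, Y ⊆ Fam i (J i) → Y.card ≤ bv i →
            Disjoint Y (((M ∩ Fam i (J i)) ∪ X) ∪ (B ∩ Fam i (J i))) →
            LW A (av i) c (bv i) (Fam i (J i)) (k i) ((M ∩ Fam i (J i)) ∪ X)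
              ((B ∩ Fam i (J i)) ∪ Y) := by
        intro i
        rcases hGg i (J i) (hJ i) with h | h
        · exact absurd ⟨i, h⟩ hwin
        · exact h
      choose X hXF hXc hXd hXw using hmv
      rw [show l + 1 + n = (l + n) + 1 by omega]
      -- the combined move
      have hXX : ∀ i, Finset.univ.biUnion X ∩ Fam i (J i) = X i := by
        intro i
        ext x
        simp only [Finset.mem_inter, Finset.mem_biUnion, Finset.mem_univ, true_and]
        constructor
        · rintro ⟨⟨i', hx⟩, hx'⟩
          have := (hdisj i' (J i') i (J i) ⟨x, hXF i' hx, hx'⟩).1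
          rwa [this] at hx
        · intro hx; exact ⟨⟨i, hx⟩, hXF i hx⟩
      have hXO : ∀ i j, j ≠ J i → Finset.univ.biUnion X ∩ Fam i j = ∅ := by
        intro i j hj
        rw [Finset.eq_empty_iff_forall_notMem]
        intro x hx
        simp only [Finset.mem_inter, Finset.mem_biUnion, Finset.mem_univ, true_and] at hx
        obtain ⟨⟨i', hx⟩, hx'⟩ := hx
        have := hdisj i' (J i') i j ⟨x, hXF i' hx, hx'⟩
        obtain ⟨rfl, h2⟩ := this
        exact hj h2.symm
      refine ⟨Finset.univ.biUnion X, ?_, ?_, ?_⟩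
      · rw [Finset.card_biUnion, hc]
        · exact Finset.sum_congr rfl (fun i _ => hXc i)
        · intro i _ i' _ hii
          change Disjoint _ _
          rw [Finset.disjoint_left]
          intro x hx hx'
          exact hii (hdisj i (J i) i' (J i') ⟨x, hXF i hx, hXF i' hx'⟩).1
      · rw [Finset.disjoint_biUnion_left]
        intro i _
        have hd := hXd i
        rw [Finset.disjoint_left] at hd ⊢
        intro x hx hx'
        apply hd hx
        have := hXF i hx
        simp only [Finset.mem_union, Finset.mem_inter] at hx' ⊢
        tauto
      · intro Z hZc hZd
        set XX := Finset.univ.biUnion X with hXXdef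
        set q1 : Fin s → ℕ → ℕ := fun i j => if j = J i then bv i + 1 else q i j with hq1
        have hpend1 : ∀ i j, Pend A av bv c Fam i j (k i) (q1 i j) (M ∪ XX) B := by
          intro i j
          by_cases hj : j = J i
          · subst hj
            intro Y hY hYd hYc
            rw [Finset.union_inter_distrib_right, hXX]
            apply hXw i Y hY
            · simp only [hq1, if_true] at hYc
              omega
            · apply hYd.mono_right
              have : X i ⊆ XX := Finset.subset_biUnion_of_mem X (Finset.mem_univ i)
              intro x hx
              have := @this x
              simp only [Finset.mem_union, Finset.mem_inter] at hx ⊢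
              tauto
          · intro Y hY hYd hYc
            rw [Finset.union_inter_distrib_right, hXO i j hj, Finset.union_empty]
            apply hqp i j Y hY
            · apply hYd.mono_right
              intro x hx
              simp only [Finset.mem_union] at hx ⊢
              tauto
            · simpa only [hq1, if_neg hj] using hYc
        refine ih (M ∪ XX) (B ∪ Z)
          (fun i => ((G i).erase (J i)).filter (fun j => Disjoint Z (Fam i j)))
          (fun i j => q1 i j - (Z ∩ Fam i j).card) ?_ ?_ ?_ ?_ ?_ ?_ ?_
        · intro i
          exact (Finset.filter_subset _ _).trans ((Finset.erase_subset _ _).trans (hGU i))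
        · intro i
          have h1 := touch_card hdisj i ((G i).erase (J i)) Z
          have h2 := Finset.card_filter_add_card_filter_not (s := (G i).erase (J i))
            (fun j => Disjoint Z (Fam i j))
          have h3 := Finset.card_erase_of_mem (hJ i)
          have h4 := hGc i
          rw [Nat.succ_mul] at h4
          omega
        · intro i j hj
          rw [Finset.mem_filter, Finset.mem_erase] at hj
          have := hGg i j hj.1.2
          unfold Good at this ⊢
          rw [Finset.union_inter_distrib_right, hXO i j hj.1.1, Finset.union_empty,
            Finset.union_inter_distrib_right, Finset.disjoint_iff_inter_eq_empty.1 hj.2,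
            Finset.union_empty]
          exact this
        · intro i j hj
          rw [Finset.mem_filter, Finset.mem_erase] at hj
          simp only [hq1, if_neg hj.1.1, hq0 i j hj.1.2, Nat.zero_sub]
        · intro i j
          refine (Nat.sub_le _ _).trans ?_
          simp only [hq1]
          split_ifs
          · rw [hb]
            exact Finset.single_le_sum (f := fun i => bv i + 1)
              (fun _ _ => Nat.zero_le _) (Finset.mem_univ i)
          · exact hqb i j
        · intro i j
          exact (hpend1 i j).breaker hZd
        · have e1 : ∑ i, ∑ j ∈ U, q1 i j = ∑ i, ∑ j ∈ U, q i j + ∑ i, (bv i + 1) := by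
            rw [← Finset.sum_add_distrib]
            apply Finset.sum_congr rfl
            intro i _
            have hJU := hGU i (hJ i)
            rw [← Finset.add_sum_erase U _ hJU, ← Finset.add_sum_erase U (q i) hJU,
              hq0 i _ (hJ i)]
            have : ∑ j ∈ U.erase (J i), q1 i j = ∑ j ∈ U.erase (J i), q i j := by
              apply Finset.sum_congr rfl
              intro j hj
              simp only [hq1, if_neg (Finset.ne_of_mem_erase hj)]
            rw [this]
            simp only [hq1, if_true]
            omega
          have e2 := touch_sum hdisj U Z
          have e3 : ∑ i, ∑ j ∈ U, q1 i j ≤ ∑ i, ∑ j ∈ U, (q1 i j - (Z ∩ Fam i j).card) +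
              ∑ i, ∑ j ∈ U, (Z ∩ Fam i j).card := by
            rw [← Finset.sum_add_distrib]
            apply Finset.sum_le_sum
            intro i _
            rw [← Finset.sum_add_distrib]
            apply Finset.sum_le_sum
            intro j _
            omega
          omega

theorem all_stages (hs : 1 ≤ s)
    (hdisj : ∀ i j i' j', (∃ x, x ∈ Fam i j ∧ x ∈ Fam i' j') → i = i' ∧ j = j')
    (hc : c = ∑ i, av i) (b' : ℕ) (hb : b' + 1 = ∑ i, (bv i + 1)) :
    ∀ (K : ℕ) (k : Fin s → ℕ), ∑ i, k i = K → ∃ R n, ∀ M B,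
      (∀ i, ∃ G : Finset ℕ, R ≤ G.card ∧ ∀ j ∈ G, Good A av bv c Fam i j (k i) M B) →
      WinsIn A c b' n M B := by
  intro K
  induction K with
  | zero =>
    intro k hk
    refine ⟨1, 0, fun M B h => ?_⟩
    obtain ⟨G, hG, hg⟩ := h ⟨0, hs⟩
    obtain ⟨j, hj⟩ := Finset.card_pos.1 hG
    have h0 : k ⟨0, hs⟩ = 0 := by
      rw [Finset.sum_eq_zero_iff] at hk
      exact hk _ (Finset.mem_univ _)
    have := hg j hj
    rw [h0] at this
    exact this.elim
  | succ K ih =>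
    intro k hk
    by_cases h0 : ∃ i, k i = 0
    · obtain ⟨i, h0⟩ := h0
      refine ⟨1, 0, fun M B h => ?_⟩
      obtain ⟨G, hG, hg⟩ := h i
      obtain ⟨j, hj⟩ := Finset.card_pos.1 hG
      have := hg j hj
      rw [h0] at this
      exact this.elim
    · push Not at h0
      obtain ⟨k', hk'⟩ : ∃ k' : Fin s → ℕ, ∀ i, k i = k' i + 1 :=
        ⟨fun i => k i - 1, fun i => by have := h0 i; show k i = k i - 1 + 1; omega⟩
      have hstep : ∀ i₀ : Fin s, ∑ i, (if i = i₀ then k' i else k' i + 1) = K := by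
        intro i₀
        have : ∑ i, k i = ∑ i, (if i = i₀ then k' i else k' i + 1) +
            ∑ i, (if i = i₀ then 1 else 0) := by
          rw [← Finset.sum_add_distrib]
          apply Finset.sum_congr rfl
          intro i _
          rw [hk' i]
          split_ifs <;> omega
        rw [Finset.sum_ite_eq' Finset.univ i₀, if_pos (Finset.mem_univ _)] at this
        omega
      choose R n hRn using fun i₀ => ih _ (hstep i₀)
      have hRle : ∀ i, R i ≤ ∑ i, R i := fun i =>
        Finset.single_le_sum (f := R) (fun _ _ => Nat.zero_le _) (Finset.mem_univ i)
      have hnle : ∀ i, n i ≤ ∑ i, n i := fun i =>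
        Finset.single_le_sum (f := n) (fun _ _ => Nat.zero_le _) (Finset.mem_univ i)
      set R' := ∑ i, R i
      set n' := ∑ i, n i
      set L := s * (R' * (b' + 1))
      refine ⟨R' + L * (1 + b'), L + n', fun M B h => ?_⟩
      choose G hGc hGg using h
      refine stage hs hdisj hc b' hb k' R' n' ?_ (Finset.univ.biUnion G) L le_rfl L M B G
        (fun _ _ => 0) (fun i => Finset.subset_biUnion_of_mem G (Finset.mem_univ i)) hGc ?_
        (fun _ _ _ => rfl) (fun _ _ => Nat.zero_le _) ?_ (Nat.le_add_right _ _)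
      · rintro M B ⟨i₀, hi₀⟩
        refine (hRn i₀ M B fun i => ?_).mono (hnle i₀)
        obtain ⟨G, h1, h2⟩ := hi₀ i
        exact ⟨G, (hRle i₀).trans h1, h2⟩
      · intro i j hj
        rw [← hk' i]
        exact hGg i j hj
      · intro i j Y _ _ hY
        exact absurd hY (Nat.not_lt_zero _)

end Main

/-- If `a = a₁ + ⋯ + a_s`, `b = b₁ + ⋯ + b_s`, and the polyomino `A` is a bounded
`(aᵢ → a, bᵢ)`-winner for every `i`, then `A` is an `(a, b + s - 1)`-winner. -/
theorem main_decomposition (s : ℕ) (hs : 1 ≤ s) (av bv : Fin s → ℕ)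
    (A : Finset Cell) (hA : IsPolyomino A)
    (h : ∀ i : Fin s, IsBoundedArrowWinner A (av i) (∑ j, av j) (bv i)) :
    IsWinner A (∑ j, av j) ((∑ j, bv j) + s - 1) := by
  choose N F hLW using fun i => lw_of_bounded (h i)
  obtain ⟨t, ht⟩ := exists_family F
  obtain ⟨R, n, hR⟩ := all_stages (A := A) (av := av) (bv := bv)
    (Fam := fun i j => trn (t i j) (F i)) hs ht rfl ((∑ j, bv j) + s - 1)
    (by simp [Finset.sum_add_distrib]; omega) (∑ i, N i) N rfl
  refine isWinner_of_winsIn (hR ∅ ∅ fun i => ⟨Finset.range R, by simp, fun j _ => ?_⟩)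
  have := trn_LW (t i j) (hLW i)
  simpa [Good, trn] using this
end

section
/- Let a ≥ 1 and b ∈ ℕ, and let A be a polyomino. If A is a bounded (1→a, ⌊b/a⌋)-winner, then A is an (a,b)-winner. -/
namespace RW

def Placed (A : Finset Cell) (M : Finset Cell) : Prop :=
  ∃ P : Set Cell, IsPlacement A P ∧ P ⊆ ↑M

theorem Placed.mono {A M M' : Finset Cell} (h : Placed A M) (hs : M ⊆ M') : Placed A M' := by
  obtain ⟨P, hP, hPM⟩ := h
  exact ⟨P, hP, hPM.trans (by exact_mod_cast hs)⟩

theorem Placed.translate {A M : Finset Cell} (h : Placed A M) (t : Cell) :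
    Placed A (M.image (fun p => p + t)) := by
  obtain ⟨P, ⟨f, ⟨e₁, e₂, s, u, h1, h2, hf⟩, rfl⟩, hPM⟩ := h
  refine ⟨_, ⟨fun p => f p + t, ⟨e₁, e₂, s, u + t, h1, h2, ?_⟩, rfl⟩, ?_⟩
  · intro p
    simp only [hf]
    cases s <;> simp [Prod.ext_iff, add_assoc]
  · rintro _ ⟨p, hp, rfl⟩
    have := hPM ⟨p, hp, rfl⟩
    simp only [Finset.coe_image]
    exact ⟨_, this, rfl⟩

theorem fresh (U : Finset Cell) (n : ℕ) : ∃ X : Finset Cell, X.card = n ∧ Disjoint X U := by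
  obtain ⟨X, hX, hc⟩ := (U.finite_toSet.infinite_compl).exists_subset_card_eq n
  refine ⟨X, hc, ?_⟩
  rw [Finset.disjoint_left]
  intro x hx hxU
  exact hX hx hxU

/-- relaxed finite-horizon win -/
def Win (A : Finset Cell) (a b : ℕ) : ℕ → Finset Cell → Finset Cell → Prop
  | 0, M, _ => Placed A M
  | k + 1, M, B => ∃ X : Finset Cell, X.card ≤ a ∧ Disjoint X B ∧
      ∀ Y : Finset Cell, Y.card ≤ b → Disjoint Y (M ∪ X) → Win A a b k (M ∪ X) (B ∪ Y)

theorem Win.mono {A : Finset Cell} {a b : ℕ} : ∀ {k : ℕ} {M M' B : Finset Cell},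
    Win A a b k M B → M ⊆ M' → Win A a b k M' B
  | 0, _, _, _, h, hs => Placed.mono h hs
  | _ + 1, _, _, _, ⟨X, hX, hd, h⟩, hs => ⟨X, hX, hd, fun Y hY hYd =>
      (h Y hY (hYd.mono_right (Finset.union_subset_union_left hs))).mono
        (Finset.union_subset_union_left hs)⟩

theorem Win.succ {A : Finset Cell} {a b : ℕ} : ∀ {k : ℕ} {M B : Finset Cell},
    Win A a b k M B → Win A a b (k + 1) M B
  | 0, _, _, h => ⟨∅, by simp, by simp, fun Y _ _ => Placed.mono h (by simp)⟩
  | _ + 1, _, _, ⟨X, hX, hd, h⟩ => ⟨X, hX, hd, fun Y hY hYd => (h Y hY hYd).succ⟩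

theorem Win.le {A : Finset Cell} {a b : ℕ} {k l : ℕ} {M B : Finset Cell}
    (h : Win A a b k M B) (hl : k ≤ l) : Win A a b l M B := by
  induction l, hl using Nat.le_induction with
  | base => exact h
  | succ l _ ih => exact ih.succ

theorem step_exists (A : Finset Cell) (a b : ℕ) (s : ℕ × Finset Cell × Finset Cell) :
    ∃ X : Finset Cell, X.card = a ∧ Disjoint X (s.2.1 ∪ s.2.2) ∧
      (Win A a b s.1 s.2.1 s.2.2 → ∀ Y : Finset Cell, Y.card ≤ b → Disjoint Y (s.2.1 ∪ X) →
        Win A a b (s.1 - 1) (s.2.1 ∪ X) (s.2.2 ∪ Y)) := by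
  obtain ⟨k, M, B⟩ := s
  simp only
  by_cases hw : Win A a b k M B
  · have hw' : Win A a b (k - 1 + 1) M B := hw.le (by omega)
    obtain ⟨X, hX, hd, h⟩ := hw'
    have hc : (X \ M).card ≤ a := (Finset.card_le_card Finset.sdiff_subset).trans hX
    obtain ⟨E, hE, hEd⟩ := fresh (M ∪ B ∪ X) (a - (X \ M).card)
    have hEX : Disjoint (X \ M) E := by
      rw [Finset.disjoint_left] at *
      intro x hx hx'
      simp at hx
      exact hEd hx' (by simp [hx])
    refine ⟨(X \ M) ∪ E, ?_, ?_, ?_⟩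
    · rw [Finset.card_union_of_disjoint hEX, hE]; omega
    · rw [Finset.disjoint_left] at *
      intro x hx hx'
      have h1 := @hd x
      have h2 := @hEd x
      simp at *
      tauto
    · intro _ Y hY hYd
      have hsub : M ∪ X ⊆ M ∪ ((X \ M) ∪ E) := by
        intro x hx
        simp at *
        tauto
      exact (h Y hY (hYd.mono_right hsub)).mono hsub
  · obtain ⟨X, hX, hd⟩ := fresh (M ∪ B) a
    exact ⟨X, hX, hd, fun h => absurd h hw⟩

theorem winner_of_Win {A : Finset Cell} {a b K : ℕ} (h : Win A a b K ∅ ∅) : IsWinner A a b := by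
  choose G hG using step_exists A a b
  let st : List (Finset Cell) → ℕ × Finset Cell × Finset Cell := fun L =>
    L.foldl (fun s Y => (s.1 - 1, s.2.1 ∪ G s, s.2.2 ∪ Y)) (K, ∅, ∅)
  let σ : List (Finset Cell) → Finset Cell := fun L => G (st L)
  have hst : ∀ β n, st ((List.range n).map β) = (K - n, makerMarks σ β n, breakerMarks β n) := by
    intro β n
    induction n with
    | zero => simp [st, makerMarks, breakerMarks]
    | succ n ih =>
      have : st ((List.range (n+1)).map β) =
          (fun s Y => (s.1 - 1, s.2.1 ∪ G s, s.2.2 ∪ Y)) (st ((List.range n).map β)) (β n) := by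
        simp only [st, List.range_succ, List.map_append, List.foldl_append, List.map_cons,
          List.map_nil, List.foldl_cons, List.foldl_nil]
      rw [this]
      simp only [makerMarks, breakerMarks, makerMove, σ]
      rw [ih]
      simp only [Nat.sub_sub]
      rfl
  have hmove : ∀ β n, makerMove σ β n = G (K - n, makerMarks σ β n, breakerMarks β n) := by
    intro β n
    rw [← hst]; rfl
  refine ⟨σ, fun β hβ => ⟨fun n => ?_, K, ?_⟩⟩
  · rw [hmove]
    exact ⟨(hG _).1, (hG _).2.1⟩
  · have : ∀ n, Win A a b (K - n) (makerMarks σ β n) (breakerMarks β n) := by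
      intro n
      induction n with
      | zero => simpa [makerMarks, breakerMarks] using h
      | succ n ih =>
        have h1 := (hG (K - n, makerMarks σ β n, breakerMarks β n)).2.2 ih (β n) (hβ n).1.le
        rw [← hmove] at h1
        exact h1 ((hβ n).2.mono_right Finset.subset_union_left)
    have h2 := this K
    rw [Nat.sub_self] at h2
    exact h2

/-! single board -/

def Dn (A F : Finset Cell) (a : ℕ) (M B : Finset Cell) : Prop :=
  ∃ X : Finset Cell, X ⊆ F ∧ X.card ≤ a ∧ Disjoint X B ∧ Placed A (M ∪ X)

def AW (A F : Finset Cell) (a q : ℕ) : ℕ → Finset Cell → Finset Cell → Prop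
  | 0, M, B => Dn A F a M B
  | k + 1, M, B => Dn A F a M B ∨ ∃ x ∈ F, x ∉ B ∧ ∀ Y ⊆ F, Y.card ≤ q →
      Disjoint Y (insert x M) → AW A F a q k (insert x M) (B ∪ Y)

theorem Dn.mono {A F : Finset Cell} {a : ℕ} {M M' B : Finset Cell} (h : Dn A F a M B)
    (hs : M ⊆ M') : Dn A F a M' B := by
  obtain ⟨X, h1, h2, h3, h4⟩ := h
  exact ⟨X, h1, h2, h3, h4.mono (Finset.union_subset_union_left hs)⟩

theorem AW.mono {A F : Finset Cell} {a q : ℕ} : ∀ {k : ℕ} {M M' B : Finset Cell},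
    AW A F a q k M B → M ⊆ M' → AW A F a q k M' B
  | 0, _, _, _, h, hs => Dn.mono h hs
  | _ + 1, _, _, _, .inl h, hs => .inl (Dn.mono h hs)
  | _ + 1, _, _, _, .inr ⟨x, hx, hd, h⟩, hs => .inr ⟨x, hx, hd, fun Y hY hc hYd =>
      (h Y hY hc (hYd.mono_right (Finset.insert_subset_insert _ hs))).mono
        (Finset.insert_subset_insert _ hs)⟩

theorem makerMove_congr (σ : List (Finset Cell) → Finset Cell) {β β' : ℕ → Finset Cell} {n : ℕ}
    (h : ∀ i < n, β i = β' i) : makerMove σ β n = makerMove σ β' n := by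
  unfold makerMove
  congr 1
  apply List.map_congr_left
  intro i hi
  exact h i (List.mem_range.1 hi)

theorem makerMarks_congr (σ : List (Finset Cell) → Finset Cell) {β β' : ℕ → Finset Cell} :
    ∀ {n : ℕ}, (∀ i, i + 1 < n → β i = β' i) → makerMarks σ β n = makerMarks σ β' n
  | 0, _ => rfl
  | n + 1, h => by
    simp only [makerMarks]
    rw [makerMarks_congr σ (n := n) (fun i hi => h i (by omega)),
      makerMove_congr σ (n := n) (fun i hi => h i (by omega))]

theorem breakerMarks_congr {β β' : ℕ → Finset Cell} :
    ∀ {n : ℕ}, (∀ i < n, β i = β' i) → breakerMarks β n = breakerMarks β' n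
  | 0, _ => rfl
  | n + 1, h => by
    simp only [breakerMarks]
    rw [breakerMarks_congr (n := n) (fun i hi => h i (by omega)), h n (by omega)]

def LegalUpTo (b : ℕ) (σ : List (Finset Cell) → Finset Cell) (β : ℕ → Finset Cell) (N : ℕ) :
    Prop :=
  ∀ n < N, (β n).card = b ∧ Disjoint (β n) (makerMarks σ β (n + 1) ∪ breakerMarks β n)

theorem extend {b : ℕ} {σ : List (Finset Cell) → Finset Cell} {β : ℕ → Finset Cell} {n : ℕ}
    (h : LegalUpTo b σ β n) : ∃ β', (∀ i < n, β' i = β i) ∧ BreakerLegal b σ β' := by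
  have hfr : ∀ L : List (Finset Cell), ∃ X : Finset Cell, X.card = b ∧
      Disjoint X (makerMarks σ (fun i => L.getD i ∅) (L.length + 1) ∪
        breakerMarks (fun i => L.getD i ∅) L.length) := fun L => fresh _ b
  choose g hg using hfr
  let H : ℕ → List (Finset Cell) := fun m =>
    Nat.rec [] (fun m L => L ++ [if m < n then β m else g L]) m
  let β' : ℕ → Finset Cell := fun m => if m < n then β m else g (H m)
  have hH : ∀ m, H m = (List.range m).map β' := by
    intro m
    induction m with
    | zero => rfl
    | succ m ih =>
      rw [List.range_succ, List.map_append, ← ih]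
      rfl
  have hag : ∀ i < n, β' i = β i := fun i hi => by simp [β', hi]
  refine ⟨β', hag, fun m => ?_⟩
  by_cases hm : m < n
  · rw [makerMarks_congr σ (β' := β) (fun i hi => hag i (by omega)),
      breakerMarks_congr (β' := β) (fun i hi => hag i (by omega)), hag m hm]
    exact h m hm
  · have h1 : β' m = g (H m) := by simp [β', hm]
    have h2 := hg (H m)
    have hl : (H m).length = m := by rw [hH]; simp
    have hget : ∀ i < m, (H m).getD i ∅ = β' i := by
      intro i hi
      rw [hH]
      simp [List.getD, hi]
    rw [hl, makerMarks_congr σ (β' := β') (fun i hi => hget i (by omega)),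
      breakerMarks_congr (β' := β') (fun i hi => hget i hi)] at h2
    rw [h1]
    exact h2

theorem makerMarks_mono (σ : List (Finset Cell) → Finset Cell) (β : ℕ → Finset Cell) :
    Monotone (makerMarks σ β) :=
  monotone_nat_of_le_succ fun _ => Finset.subset_union_left

theorem AW_of_arrow {A F : Finset Cell} {a q N : ℕ} {σ : List (Finset Cell) → Finset Cell}
    (h : ∀ β : ℕ → Finset Cell, BreakerLegal q σ β →
      ∃ T : ℕ, T + 1 ≤ N ∧
        (∀ n ≤ T, Disjoint (makerMove σ β n) (makerMarks σ β n ∪ breakerMarks β n) ∧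
          makerMove σ β n ⊆ F) ∧
        (∀ n < T, (makerMove σ β n).card = 1) ∧
        (makerMove σ β T).card = a ∧
        ∃ P : Set Cell, IsPlacement A P ∧ P ⊆ ↑(makerMarks σ β (T + 1))) :
    ∀ k n (β : ℕ → Finset Cell), n + k = N → LegalUpTo q σ β n →
      AW A F a q k (makerMarks σ β n) (breakerMarks β n ∩ F) := by
  have key : ∀ n (β : ℕ → Finset Cell), LegalUpTo q σ β n →
      Dn A F a (makerMarks σ β n) (breakerMarks β n ∩ F) ∨
      (n + 1 < N ∧ ∃ x ∈ F, x ∉ breakerMarks β n ∧ makerMove σ β n = {x}) := by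
    intro n β hβ
    obtain ⟨β', hag, hL⟩ := extend hβ
    obtain ⟨T, hT, h1, h2, h3, h4⟩ := h β' hL
    have e1 : makerMarks σ β' n = makerMarks σ β n :=
      makerMarks_congr σ (fun i hi => hag i (by omega))
    have e2 : makerMove σ β' n = makerMove σ β n := makerMove_congr σ hag
    have e3 : breakerMarks β' n = breakerMarks β n := breakerMarks_congr hag
    rcases lt_trichotomy T n with hlt | rfl | hgt
    · left
      refine ⟨∅, by simp, by simp, by simp, ?_⟩
      rw [← e1]
      exact Placed.mono h4 ((makerMarks_mono σ β' hlt).trans Finset.subset_union_left)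
    · left
      have := h1 T le_rfl
      refine ⟨makerMove σ β' T, this.2, h3.le, ?_, ?_⟩
      · rw [← e3]
        exact this.1.mono_right (Finset.inter_subset_left.trans Finset.subset_union_right)
      · rw [← e1]; exact h4
    · right
      have h5 := h1 n hgt.le
      have h6 := h2 n hgt
      rw [e1, e2, e3] at h5
      rw [e2] at h6
      obtain ⟨x, hx⟩ := Finset.card_eq_one.1 h6
      rw [hx] at h5
      simp at h5
      exact ⟨by omega, x, h5.2, h5.1.2, hx⟩
  intro k
  induction k with
  | zero =>
    intro n β hn hβ
    rcases key n β hβ with h | h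
    · exact h
    · omega
  | succ k ih =>
    intro n β hn hβ
    rcases key n β hβ with h | ⟨_, x, hxF, hxB, hx⟩
    · exact .inl h
    · right
      refine ⟨x, hxF, by simp [hxB], fun Y hYF hYc hYd => ?_⟩
      set Y' := Y \ breakerMarks β n with hY'
      have hY'c : Y'.card ≤ q := (Finset.card_le_card Finset.sdiff_subset).trans hYc
      obtain ⟨E, hEc, hEd⟩ := fresh (F ∪ insert x (makerMarks σ β n) ∪ breakerMarks β n)
        (q - Y'.card)
      have hYE : Disjoint Y' E := by
        rw [Finset.disjoint_left] at *
        intro y hy hyE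
        have := hYF (Finset.sdiff_subset hy)
        exact hEd hyE (by simp [this])
      let β' := Function.update β n (Y' ∪ E)
      have hag : ∀ i < n, β' i = β i := fun i hi => by simp [β', hi.ne]
      have hn' : β' n = Y' ∪ E := by simp [β']
      have e1 : makerMarks σ β' (n + 1) = insert x (makerMarks σ β n) := by
        rw [makerMarks_congr σ (β' := β) (fun i hi => hag i (by omega))]
        simp only [makerMarks, hx]
        ext y; simp [or_comm]
      have e2 : breakerMarks β' n = breakerMarks β n := breakerMarks_congr hag
      have hleg : LegalUpTo q σ β' (n + 1) := by
        intro m hm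
        rcases Nat.lt_succ_iff_lt_or_eq.1 hm with hm | rfl
        · rw [makerMarks_congr σ (β' := β) (fun i hi => hag i (by omega)),
            breakerMarks_congr (β' := β) (fun i hi => hag i (by omega)), hag m hm]
          exact hβ m hm
        · rw [hn', e1, e2]
          refine ⟨?_, ?_⟩
          · rw [Finset.card_union_of_disjoint hYE, hEc]; omega
          · rw [Finset.disjoint_left] at *
            intro y hy hy'
            have h1 := @hYd y
            have h2 := @hEd y
            simp [hY'] at *
            tauto
      have := ih (n + 1) β' (by omega) hleg
      rw [e1] at this
      convert this using 1
      simp only [breakerMarks, e2, hn']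
      ext y
      rw [Finset.disjoint_left] at hEd
      have h2 := @hEd y
      have h3 := @hYF y
      simp [hY'] at *
      tauto

/-! many boards -/

def pull (F M : Finset Cell) (t : Cell) : Finset Cell := F.filter (fun p => p + t ∈ M)

theorem mem_pull {F M : Finset Cell} {t p : Cell} : p ∈ pull F M t ↔ p ∈ F ∧ p + t ∈ M := by
  simp [pull]

def Sep (F J : Finset Cell) : Prop :=
  ∀ t ∈ J, ∀ t' ∈ J, ∀ p ∈ F, ∀ p' ∈ F, p + t = p' + t' → t = t'

theorem sum_pull {F J : Finset Cell} (h : Sep F J) (Z : Finset Cell) :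
    ∑ t ∈ J, (pull F Z t).card ≤ Z.card := by
  have : ∀ t ∈ J, (pull F Z t).card = ((pull F Z t).image (fun p => p + t)).card := by
    intro t _
    rw [Finset.card_image_of_injective _ (add_left_injective t)]
  rw [Finset.sum_congr rfl this, ← Finset.card_biUnion]
  · apply Finset.card_le_card
    intro z hz
    simp only [Finset.mem_biUnion, Finset.mem_image, mem_pull] at hz
    obtain ⟨t, _, p, hp, rfl⟩ := hz
    exact hp.2
  · intro t ht t' ht' hne
    rw [Function.onFun, Finset.disjoint_left]
    intro z hz hz'
    simp only [Finset.mem_image, mem_pull] at hz hz'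
    obtain ⟨p, hp, rfl⟩ := hz
    obtain ⟨p', hp', he⟩ := hz'
    exact hne (h t ht t' ht' p hp.1 p' hp'.1 he.symm)

theorem card_bad {F J : Finset Cell} (h : Sep F J) (Z : Finset Cell) (q : ℕ) :
    (J.filter (fun t => ¬ (pull F Z t).card ≤ q)).card * (q + 1) ≤ Z.card := by
  refine le_trans ?_ (sum_pull h Z)
  rw [← smul_eq_mul]
  refine le_trans (Finset.card_nsmul_le_sum _ (fun t => (pull F Z t).card) (q + 1) ?_)
    (Finset.sum_le_sum_of_subset (Finset.filter_subset _ _))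
  intro t ht
  simp at ht
  omega

theorem win_of_Dn {A F : Finset Cell} {a b : ℕ} {M B : Finset Cell} {t : Cell}
    (h : Dn A F a (pull F M t) (pull F B t)) : Win A a b 1 M B := by
  obtain ⟨X, hXF, hXc, hXd, hP⟩ := h
  refine ⟨X.image (fun p => p + t), Finset.card_image_le.trans hXc, ?_, fun Y _ _ => ?_⟩
  · rw [Finset.disjoint_left] at *
    intro z hz hz'
    simp only [Finset.mem_image] at hz
    obtain ⟨p, hp, rfl⟩ := hz
    exact hXd hp (mem_pull.2 ⟨hXF hp, hz'⟩)
  · refine (hP.translate t).mono ?_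
    intro z hz
    simp only [Finset.mem_image, Finset.mem_union, mem_pull] at hz ⊢
    obtain ⟨p, hp, rfl⟩ := hz
    rcases hp with hp | hp
    · exact .inl hp.2
    · exact .inr ⟨p, hp, rfl⟩

/-- One phase. -/
theorem phase {A F : Finset Cell} {a b q m K : ℕ} {J M₀ B₀ : Finset Cell} (hJ : Sep F J)
    (x : Cell → Cell) (hxF : ∀ t ∈ J, x t ∈ F) (hxB : ∀ t ∈ J, x t ∉ pull F B₀ t)
    (s : ℕ) (good : ∀ M Z Jm : Finset Cell, M₀ ⊆ M → Jm ⊆ J → Jm.card = a * s →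
      Z.card ≤ b * s → Disjoint Z M → (∀ t ∈ Jm, x t + t ∈ M) → Win A a b K M (B₀ ∪ Z)) :
    ∀ r ≤ s, ∀ M Z Jm Ju : Finset Cell, M₀ ⊆ M → Jm ⊆ J → Ju ⊆ J → Disjoint Jm Ju →
      Jm.card = a * (s - r) → (a + b) * r ≤ Ju.card → Z.card ≤ b * (s - r) → Disjoint Z M →
      (∀ t ∈ Jm, x t + t ∈ M) → (∀ t ∈ Ju, pull F Z t = ∅) →
      Win A a b (r + K) M (B₀ ∪ Z) := by
  intro r
  induction r with
  | zero =>
    intro _ M Z Jm Ju hM hJm _ _ hc _ hZ hd hx _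
    rw [Nat.zero_add]
    exact good M Z Jm hM hJm (by simpa using hc) (by simpa using hZ) hd hx
  | succ r ih =>
    intro hr M Z Jm Ju hM hJm hJu hdj hc hcu hZ hd hx hu
    have hsr : s - r = s - (r + 1) + 1 := by omega
    have haJ : a ≤ Ju.card := by nlinarith
    obtain ⟨T, hTJ, hTc⟩ := Finset.exists_subset_card_eq haJ
    rw [show r + 1 + K = (r + K) + 1 by omega]
    have hTd : ∀ z ∈ T.image (fun t => x t + t), z ∉ B₀ ∪ Z := by
      intro z hz hz'
      simp only [Finset.mem_image] at hz
      obtain ⟨t, ht, rfl⟩ := hz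
      have htJ := hJu (hTJ ht)
      rcases Finset.mem_union.1 hz' with h | h
      · exact hxB t htJ (mem_pull.2 ⟨hxF t htJ, h⟩)
      · have : x t ∈ pull F Z t := mem_pull.2 ⟨hxF t htJ, h⟩
        rw [hu t (hTJ ht)] at this
        simp at this
    refine ⟨T.image (fun t => x t + t), Finset.card_image_le.trans hTc.le,
      Finset.disjoint_left.2 hTd, fun Y hYc hYd => ?_⟩
    rw [Finset.union_assoc]
    refine ih (by omega) _ (Z ∪ Y) (Jm ∪ T) ((Ju \ T).filter (fun t => (pull F Y t).card ≤ 0))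
      (hM.trans Finset.subset_union_left) (Finset.union_subset hJm (hTJ.trans hJu))
      (((Finset.filter_subset _ _).trans Finset.sdiff_subset).trans hJu) ?_ ?_ ?_ ?_ ?_ ?_ ?_
    · rw [Finset.disjoint_left] at *
      intro t ht ht'
      have := @hdj t
      simp at *
      tauto
    · rw [Finset.card_union_of_disjoint (hdj.mono_right hTJ), hc, hTc, hsr]
      ring
    · have h1 := card_bad (J := Ju \ T)
        (fun t ht t' ht' => hJ t (hJu (Finset.sdiff_subset ht)) t' (hJu (Finset.sdiff_subset ht')))
        Y 0
      have h2 := Finset.card_filter_add_card_filter_not (s := Ju \ T) (fun t => (pull F Y t).card ≤ 0)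
      have h3 := Finset.card_sdiff_add_card_eq_card hTJ
      rw [mul_add] at hcu
      omega
    · rw [hsr]
      have := Finset.card_union_le Z Y
      rw [mul_add]
      omega
    · rw [Finset.disjoint_left] at *
      intro z hz hz'
      have h1 := @hYd z
      have h2 := @hd z
      have h3 := hTd z
      simp only [Finset.mem_union] at *
      tauto
    · intro t ht
      rcases Finset.mem_union.1 ht with h | h
      · exact Finset.mem_union_left _ (hx t h)
      · exact Finset.mem_union_right _ (Finset.mem_image_of_mem (fun t => x t + t) h)
    · intro t ht
      simp only [Finset.mem_filter, Finset.mem_sdiff, Nat.le_zero, Finset.card_eq_zero] at ht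
      have h1 := hu t ht.1.1
      rw [Finset.eq_empty_iff_forall_notMem] at *
      intro p hp
      rw [mem_pull, Finset.mem_union] at hp
      rcases hp.2 with h | h
      · exact h1 p (mem_pull.2 ⟨hp.1, h⟩)
      · have := ht.2
        exact this p (mem_pull.2 ⟨hp.1, h⟩)

theorem multi (A F : Finset Cell) (a b q : ℕ) (hq : b < a * (q + 1)) : ∀ k, ∃ m K : ℕ,
    ∀ M B J : Finset Cell, Sep F J → m ≤ J.card →
      (∀ t ∈ J, AW A F a q k (pull F M t) (pull F B t)) → Win A a b K M B := by
  intro k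
  induction k with
  | zero =>
    refine ⟨1, 1, fun M B J _ hc h => ?_⟩
    obtain ⟨t, ht⟩ := Finset.card_pos.1 hc
    exact win_of_Dn (h t ht)
  | succ k ih =>
    obtain ⟨m, K, ih⟩ := ih
    set s := (q + 1) * m with hs
    refine ⟨(a + b) * s, s + K + 1, fun M₀ B₀ J hJ hc h => ?_⟩
    by_cases hD : ∃ t ∈ J, Dn A F a (pull F M₀ t) (pull F B₀ t)
    · obtain ⟨t, _, ht⟩ := hD
      exact (win_of_Dn ht).le (by omega)
    push Not at hD
    have h' : ∀ t, ∃ x, t ∈ J → x ∈ F ∧ x ∉ pull F B₀ t ∧ ∀ Y ⊆ F, Y.card ≤ q →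
        Disjoint Y (insert x (pull F M₀ t)) →
          AW A F a q k (insert x (pull F M₀ t)) (pull F B₀ t ∪ Y) := by
      intro t
      by_cases ht : t ∈ J
      · rcases h t ht with h | ⟨x, hx⟩
        · exact absurd h (hD t ht)
        · exact ⟨x, fun _ => hx⟩
      · exact ⟨t, fun h => absurd h ht⟩
    choose x hx using h'
    have := phase (A := A) (a := a) (b := b) (K := K) (q := q) (m := m) (M₀ := M₀) (B₀ := B₀) hJ x
      (fun t ht => (hx t ht).1) (fun t ht => (hx t ht).2.1) s ?_ s le_rfl M₀ ∅ ∅ J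
      subset_rfl (by simp) subset_rfl (by simp) (by simp) hc (by simp) (by simp) (by simp)
      (by simp [pull])
    · rw [Finset.union_empty] at this
      exact this.succ
    · intro M Z Jm hM hJm hJc hZ hd hxM
      have hSm : Sep F Jm := fun t ht t' ht' => hJ t (hJm ht) t' (hJm ht')
      refine ih M (B₀ ∪ Z) (Jm.filter (fun t => (pull F Z t).card ≤ q)) ?_ ?_ ?_
      · intro t ht t' ht'
        exact hSm t (Finset.filter_subset _ _ ht) t' (Finset.filter_subset _ _ ht')
      · have h1 := card_bad hSm Z q
        have h2 := Finset.card_filter_add_card_filter_not (s := Jm) (fun t => (pull F Z t).card ≤ q)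
        rw [hJc] at h2
        set u := (Jm.filter (fun t => (pull F Z t).card ≤ q)).card
        set v := (Jm.filter (fun t => ¬ (pull F Z t).card ≤ q)).card
        have h3 : (b + 1) * s ≤ a * (q + 1) * s := Nat.mul_le_mul_right _ hq
        have h4 : (u + v) * (q + 1) = a * (q + 1) * s := by rw [h2]; ring
        have h5 : (q + 1) * m ≤ (q + 1) * u := by rw [← hs]; nlinarith
        exact Nat.le_of_mul_le_mul_left h5 (by omega)
      · intro t ht
        rw [Finset.mem_filter] at ht
        obtain ⟨htm, htc⟩ := ht
        obtain ⟨h1, h2, h3⟩ := hx t (hJm htm)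
        have hsub : insert (x t) (pull F M₀ t) ⊆ pull F M t := by
          intro p hp
          rcases Finset.mem_insert.1 hp with rfl | hp
          · exact mem_pull.2 ⟨h1, hxM t htm⟩
          · exact mem_pull.2 ⟨(mem_pull.1 hp).1, hM (mem_pull.1 hp).2⟩
        have h4 := (h3 (pull F Z t) (Finset.filter_subset _ _) htc ?_).mono hsub
        · convert h4 using 1
          ext p
          simp only [mem_pull, Finset.mem_union]
          tauto
        · refine Disjoint.mono_right hsub ?_
          rw [Finset.disjoint_left] at *
          intro p hp hp'
          exact hd (mem_pull.1 hp).2 (mem_pull.1 hp').2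

theorem exists_sep (F : Finset Cell) (m : ℕ) : ∃ J : Finset Cell, Sep F J ∧ m ≤ J.card := by
  let L : ℤ := ∑ p ∈ F, |p.1| + 1
  have hL : ∀ p ∈ F, |p.1| < L := by
    intro p hp
    have := Finset.single_le_sum (f := fun p : Cell => |p.1|) (fun i _ => abs_nonneg _) hp
    simp only [L]
    omega
  have hL0 : 0 < L := by
    have := Finset.sum_nonneg (s := F) (f := fun p : Cell => |p.1|) (fun i _ => abs_nonneg _)
    simp only [L]
    omega
  have hinj : Function.Injective (fun i : ℕ => ((2 * L * i, 0) : Cell)) := by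
    intro i j hij
    simp only [Prod.mk.injEq, and_true] at hij
    have := mul_left_cancel₀ (by omega : (2 * L) ≠ 0) hij
    exact_mod_cast this
  refine ⟨(Finset.range m).image (fun i : ℕ => ((2 * L * i, 0) : Cell)), ?_, ?_⟩
  · intro t ht t' ht' p hp p' hp' he
    simp only [Finset.mem_image] at ht ht'
    obtain ⟨i, _, rfl⟩ := ht
    obtain ⟨j, _, rfl⟩ := ht'
    have h1 := abs_lt.1 (hL p hp)
    have h2 := abs_lt.1 (hL p' hp')
    have h3 := congrArg Prod.fst he
    simp only [Prod.fst_add] at h3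
    have h4 : i = j := by
      rcases lt_trichotomy i j with h | h | h
      · have : (i : ℤ) + 1 ≤ j := by exact_mod_cast h
        nlinarith
      · exact h
      · have : (j : ℤ) + 1 ≤ i := by exact_mod_cast h
        nlinarith
    rw [h4]
  · rw [Finset.card_image_of_injective _ hinj, Finset.card_range]

end RW

/-- If the polyomino `A` is a bounded `(1 → a, ⌊b/a⌋)`-winner, then it is an
`(a,b)`-winner. -/
theorem reduce_winner (A : Finset Cell) (a b : ℕ) (hA : IsPolyomino A) (ha : 1 ≤ a)
    (h : IsBoundedArrowWinner A 1 a (b / a)) : IsWinner A a b := by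
  obtain ⟨σ, N, F, h⟩ := h
  have h0 := RW.AW_of_arrow h N 0 (fun _ => ∅) (by omega) (fun n hn => by omega)
  simp only [makerMarks, breakerMarks, Finset.empty_inter] at h0
  obtain ⟨m, K, hK⟩ := RW.multi A F a b (b / a) (Nat.lt_mul_div_succ b ha) N
  obtain ⟨J, hJ, hm⟩ := RW.exists_sep F m
  refine RW.winner_of_Win (hK ∅ ∅ J hJ hm fun t _ => ?_)
  simpa [RW.pull] using h0
end

section
/- If a, b ∈ ℕ with b < a, then every polyomino A is an (a,b)-winner. -/
/-- The maker can force `G` in exactly `n` turns. -/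
def Reach (a b : ℕ) (G : Finset Cell → Finset Cell → Prop) :
    ℕ → Finset Cell → Finset Cell → Prop
  | 0, M, B => G M B
  | n + 1, M, B => ∃ S : Finset Cell, S.card = a ∧ Disjoint S (M ∪ B) ∧
      ∀ T : Finset Cell, T.card = b → Disjoint T ((M ∪ S) ∪ B) →
        Reach a b G n (M ∪ S) (B ∪ T)

theorem reach_comp {a b : ℕ} {G H : Finset Cell → Finset Cell → Prop} {m : ℕ}
    (hGH : ∀ M B, G M B → Reach a b H m M B) :
    ∀ n M B, Reach a b G n M B → Reach a b H (n + m) M B := by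
  intro n
  induction n with
  | zero => intro M B h; rw [Nat.zero_add]; exact hGH M B h
  | succ n ih =>
    rintro M B ⟨S, h1, h2, h3⟩
    rw [Nat.succ_add]
    exact ⟨S, h1, h2, fun T hT hd => ih _ _ (h3 T hT hd)⟩

/-- Position from the reversed list of breaker moves. -/
def posOf (mv : ℕ → Finset Cell → Finset Cell → Finset Cell) :
    List (Finset Cell) → Finset Cell × Finset Cell
  | [] => (∅, ∅)
  | T :: l => ((posOf mv l).1 ∪ mv l.length (posOf mv l).1 (posOf mv l).2, (posOf mv l).2 ∪ T)

theorem exists_strategy {a b N : ℕ} {G : Finset Cell → Finset Cell → Prop}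
    (h : Reach a b G N ∅ ∅) :
    ∃ σ : List (Finset Cell) → Finset Cell, ∀ β : ℕ → Finset Cell, BreakerLegal b σ β →
      MakerLegal a σ β ∧ G (makerMarks σ β N) (breakerMarks β N) := by
  have hmv : ∀ (k : ℕ) (M B : Finset Cell), ∃ S : Finset Cell, S.card = a ∧ Disjoint S (M ∪ B) ∧
      ∀ n, N - k = n + 1 → Reach a b G (n + 1) M B →
        ∀ T : Finset Cell, T.card = b → Disjoint T ((M ∪ S) ∪ B) →
        Reach a b G n (M ∪ S) (B ∪ T) := by
    intro k M B
    by_cases hk : ∃ n, N - k = n + 1 ∧ Reach a b G (n + 1) M B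
    · obtain ⟨n, hn, S, h1, h2, h3⟩ := hk
      refine ⟨S, h1, h2, ?_⟩
      intro n' hn' _
      have : n' = n := by omega
      subst this
      exact h3
    · obtain ⟨S, hS, hc⟩ := ((M ∪ B).finite_toSet.infinite_compl).exists_subset_card_eq a
      refine ⟨S, hc, ?_, fun n hn hr => absurd ⟨n, hn, hr⟩ hk⟩
      rw [Finset.disjoint_left]
      intro x hx hx'
      exact hS hx (by exact_mod_cast hx')
  choose mv h1 h2 h3 using hmv
  refine ⟨fun l => mv l.length (posOf mv l.reverse).1 (posOf mv l.reverse).2, ?_⟩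
  intro β
  generalize hσ : (fun l : List (Finset Cell) =>
    mv l.length (posOf mv l.reverse).1 (posOf mv l.reverse).2) = σ
  intro hβ
  have hpos : ∀ n, posOf mv ((List.range n).map β).reverse
      = (makerMarks σ β n, breakerMarks β n) := by
    intro n
    induction n with
    | zero => rfl
    | succ n ih =>
      rw [List.range_succ, List.map_append, List.reverse_append]
      simp only [List.map_cons, List.map_nil, List.reverse_cons, List.reverse_nil, List.nil_append,
        List.singleton_append, posOf, makerMarks, breakerMarks, makerMove]
      rw [← hσ]
      rw [← hσ] at ih
      simp only [ih, List.length_reverse]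
  have hmove : ∀ n, makerMove σ β n = mv n (makerMarks σ β n) (breakerMarks β n) := by
    intro n
    have := hpos n
    unfold makerMove
    conv_lhs => rw [← hσ]
    simp only [this, List.length_map, List.length_range]
  refine ⟨fun n => ?_, ?_⟩
  · rw [hmove]
    exact ⟨h1 _ _ _, h2 _ _ _⟩
  · have key : ∀ k, k ≤ N → Reach a b G (N - k) (makerMarks σ β k) (breakerMarks β k) := by
      intro k
      induction k with
      | zero => intro _; exact h
      | succ k ih =>
        intro hk
        have e : N - k = (N - (k + 1)) + 1 := by omega
        have ih' := ih (by omega)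
        rw [e] at ih'
        have := h3 k _ _ _ e ih' (β k) (hβ k).1 (by
          have := (hβ k).2
          rw [makerMarks, hmove] at this
          exact this)
        rw [makerMarks, hmove, breakerMarks]
        exact this
    have := key N le_rfl
    rw [Nat.sub_self] at this
    exact this

/-- Translates of `A` by elements of `F` are pairwise disjoint. -/
def BoxSep (A F : Finset Cell) : Prop :=
  ∀ t ∈ F, ∀ t' ∈ F, ∀ x ∈ A, ∀ x' ∈ A, t + x = t' + x' → t = t'

/-- Every box in `F` is untouched by the breaker and the maker has exactly `C` in it. -/
def BoxLev (A C F M B : Finset Cell) : Prop :=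
  ∀ t ∈ F, ∀ x ∈ A, (t + x ∈ M ↔ x ∈ C) ∧ t + x ∉ B

theorem BoxSep.mono {A F F' : Finset Cell} (h : BoxSep A F) (hF : F' ⊆ F) : BoxSep A F' :=
  fun t ht t' ht' => h t (hF ht) t' (hF ht')

theorem exists_sep (A : Finset Cell) (m : ℕ) : ∃ F : Finset Cell, F.card = m ∧ BoxSep A F := by
  induction m with
  | zero => exact ⟨∅, rfl, by simp [BoxSep]⟩
  | succ m ih =>
    obtain ⟨F, hF, hs⟩ := ih
    obtain ⟨t, ht⟩ := Infinite.exists_notMem_finset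
      (F ∪ ((F ×ˢ A) ×ˢ A).image (fun p => p.1.1 + p.1.2 - p.2))
    rw [Finset.mem_union, not_or] at ht
    have ht2 : ∀ t' ∈ F, ∀ x ∈ A, ∀ x' ∈ A, t + x ≠ t' + x' := by
      intro t' ht' x hx x' hx' he
      apply ht.2
      rw [Finset.mem_image]
      exact ⟨((t', x'), x), by simp [ht', hx, hx'], by simp [← he]⟩
    refine ⟨insert t F, by rw [Finset.card_insert_of_notMem ht.1, hF], ?_⟩
    intro u hu v hv x hx x' hx' he
    rw [Finset.mem_insert] at hu hv
    rcases hu with rfl | hu <;> rcases hv with rfl | hv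
    · rfl
    · exact absurd he (ht2 _ hv _ hx _ hx')
    · exact absurd he.symm (ht2 _ hu _ hx' _ hx)
    · exact hs _ hu _ hv _ hx _ hx' he

/-- Boxes of `F` not hit by `T`. -/
def alive (A F T : Finset Cell) : Finset Cell := F.filter (fun t => ∀ x ∈ A, t + x ∉ T)

theorem card_alive {A F T : Finset Cell} (h : BoxSep A F) : F.card ≤ (alive A F T).card + T.card := by
  have h0 := Finset.card_filter_add_card_filter_not (s := F) (fun t => ∀ x ∈ A, t + x ∉ T)
  have h1 : (F.filter (fun t => ¬ ∀ x ∈ A, t + x ∉ T)).card ≤ T.card := by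
    have : ∀ t : Cell, ∃ y : Cell, t ∈ F.filter (fun t => ¬ ∀ x ∈ A, t + x ∉ T) →
        y ∈ A ∧ t + y ∈ T := by
      intro t
      by_cases ht : t ∈ F.filter (fun t => ¬ ∀ x ∈ A, t + x ∉ T)
      · have := (Finset.mem_filter.1 ht).2
        push Not at this
        obtain ⟨y, hy⟩ := this
        exact ⟨y, fun _ => hy⟩
      · exact ⟨0, fun h => absurd h ht⟩
    choose w hw using this
    refine Finset.card_le_card_of_injOn (fun t => t + w t) (fun t ht => (hw t ht).2) ?_
    intro t ht t' ht' he
    exact h t (Finset.mem_filter.1 ht).1 t' (Finset.mem_filter.1 ht').1 _ (hw t ht).1 _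
      (hw t' ht').1 he
  unfold alive
  omega

/-- Intermediate invariant. -/
def BoxInv (A C C' : Finset Cell) (r s : ℕ) (M B : Finset Cell) : Prop :=
  ∃ F₁ F₂ : Finset Cell, BoxSep A (F₁ ∪ F₂) ∧ BoxLev A C F₁ M B ∧ BoxLev A C' F₂ M B ∧
    r ≤ F₁.card ∧ s ≤ F₂.card

theorem inv_step {A C : Finset Cell} {c : Cell} {a b : ℕ} (hba : b < a) (hcA : c ∈ A) (hc : c ∉ C)
    (r s : ℕ) (M B : Finset Cell) (h : BoxInv A C (insert c C) (r + a + b) s M B) :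
    Reach a b (BoxInv A C (insert c C) r (s + 1)) 1 M B := by
  obtain ⟨F₁, F₂, hs, l1, l2, hr, hs2⟩ := h
  obtain ⟨K, hK, hKc⟩ := Finset.exists_subset_card_eq (show a ≤ F₁.card by omega)
  have hdis : Disjoint F₂ K := by
    rw [Finset.disjoint_left]
    intro t ht ht'
    have e1 := (l1 t (hK ht') c hcA).1
    have e2 := (l2 t ht c hcA).1
    exact hc (e1.1 (e2.2 (Finset.mem_insert_self _ _)))
  have memS : ∀ t ∈ F₁ ∪ F₂, ∀ x ∈ A, t + x ∈ K.image (fun t => t + c) ↔ (t ∈ K ∧ x = c) := by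
    intro t ht x hx
    rw [Finset.mem_image]
    constructor
    · rintro ⟨u, hu, he⟩
      have : u = t := hs u (Finset.mem_union_left _ (hK hu)) t ht c hcA x hx he
      subst this
      exact ⟨hu, (add_left_cancel he).symm⟩
    · rintro ⟨h1, rfl⟩
      exact ⟨t, h1, rfl⟩
  refine ⟨K.image (fun t => t + c), ?_, ?_, ?_⟩
  · rw [Finset.card_image_of_injective _ (add_left_injective c), hKc]
  · rw [Finset.disjoint_left]
    intro x hx hx'
    obtain ⟨t, ht, rfl⟩ := Finset.mem_image.1 hx
    have := l1 t (hK ht) c hcA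
    rcases Finset.mem_union.1 hx' with h | h
    · exact hc (this.1.1 h)
    · exact this.2 h
  · intro T hT _
    have sub1 : F₁ \ K ⊆ F₁ ∪ F₂ := fun t ht =>
      Finset.mem_union_left _ (Finset.mem_sdiff.1 ht).1
    have sub2 : F₂ ∪ K ⊆ F₁ ∪ F₂ := by
      intro t ht
      rcases Finset.mem_union.1 ht with h | h
      · exact Finset.mem_union_right _ h
      · exact Finset.mem_union_left _ (hK h)
    have c1 := card_alive (T := T) (hs.mono sub1)
    have c2 := card_alive (T := T) (hs.mono sub2)
    rw [Finset.card_sdiff_of_subset hK] at c1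
    rw [Finset.card_union_of_disjoint hdis] at c2
    refine ⟨alive A (F₁ \ K) T, alive A (F₂ ∪ K) T, hs.mono ?_, ?_, ?_, by omega, by omega⟩
    · exact Finset.union_subset ((Finset.filter_subset _ _).trans sub1)
        ((Finset.filter_subset _ _).trans sub2)
    · intro t ht x hx
      obtain ⟨ht, hal⟩ := Finset.mem_filter.1 ht
      have m := memS t (sub1 ht) x hx
      have := l1 t (Finset.mem_sdiff.1 ht).1 x hx
      have hn := (Finset.mem_sdiff.1 ht).2
      have := hal x hx
      simp only [Finset.mem_union]
      tauto
    · intro t ht x hx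
      obtain ⟨ht, hal⟩ := Finset.mem_filter.1 ht
      have m := memS t (sub2 ht) x hx
      have := hal x hx
      rw [Finset.mem_union (s := M), Finset.mem_union (s := B), m]
      rcases Finset.mem_union.1 ht with h | h
      · have q := l2 t h x hx
        have hn : t ∉ K := Finset.disjoint_left.1 hdis h
        tauto
      · have q := l1 t (hK h) x hx
        rw [Finset.mem_insert]
        tauto

theorem inv_iter {A C : Finset Cell} {c : Cell} {a b : ℕ} (hba : b < a) (hcA : c ∈ A) (hc : c ∉ C)
    (m : ℕ) : ∀ (s : ℕ) (M B : Finset Cell), BoxInv A C (insert c C) (m * (a + b)) s M B →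
    Reach a b (BoxInv A C (insert c C) 0 (s + m)) m M B := by
  induction m with
  | zero => intro s M B h; simpa [Reach] using h
  | succ m ih =>
    intro s M B h
    have h' : BoxInv A C (insert c C) (m * (a + b) + a + b) s M B := by
      convert h using 1; ring
    have := reach_comp (ih (s + 1)) 1 M B (inv_step hba hcA hc _ _ _ _ h')
    rw [show s + (m + 1) = s + 1 + m by ring, show m + 1 = 1 + m by ring]
    exact this

theorem reach_level (A : Finset Cell) {a b : ℕ} (hba : b < a) (C : Finset Cell) :
    C ⊆ A → ∀ m, ∃ n, Reach a b
      (fun M B => ∃ F : Finset Cell, BoxSep A F ∧ BoxLev A C F M B ∧ m ≤ F.card) n ∅ ∅ := by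
  induction C using Finset.induction_on with
  | empty =>
    intro _ m
    obtain ⟨F, hF, hs⟩ := exists_sep A m
    exact ⟨0, F, hs, by simp [BoxLev], hF.ge⟩
  | insert c C hc ih =>
    intro hC m
    obtain ⟨n, hn⟩ := ih (fun x hx => hC (Finset.mem_insert_of_mem hx)) (m * (a + b))
    refine ⟨n + (m + 0), ?_⟩
    refine reach_comp ?_ n ∅ ∅ hn
    rintro M B ⟨F, hs, hl, hm⟩
    have h := inv_iter hba (hC (Finset.mem_insert_self _ _)) hc m 0 M B
      ⟨F, ∅, by simpa using hs, hl, by simp [BoxLev], hm, by simp⟩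
    refine reach_comp ?_ m M B h
    rintro M B ⟨F₁, F₂, hs, -, l2, -, h2⟩
    exact ⟨F₂, hs.mono Finset.subset_union_right, l2, by omega⟩

/-- If `b < a` then every polyomino is an `(a,b)`-winner. -/
theorem bLEa_winner (A : Finset Cell) (a b : ℕ) (hA : IsPolyomino A) (hba : b < a) :
    IsWinner A a b := by
  obtain ⟨N, hN⟩ := reach_level A hba A (Finset.Subset.refl A) 1
  obtain ⟨σ, hσ⟩ := exists_strategy hN
  refine ⟨σ, fun β hβ => ⟨(hσ β hβ).1, N, ?_⟩⟩
  obtain ⟨F, -, hl, hF⟩ := (hσ β hβ).2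
  obtain ⟨t, ht⟩ := Finset.card_pos.1 (show 0 < F.card by omega)
  refine ⟨(fun p => t + p) '' (↑A : Set Cell), ⟨_, ⟨1, 1, false, t, Or.inl rfl, Or.inl rfl, ?_⟩, rfl⟩, ?_⟩
  · intro p
    ext <;> simp [add_comm]
  · rintro _ ⟨x, hx, rfl⟩
    exact (hl t ht x hx).1.2 hx
end
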